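/- arXiv:2010.15641 — 2 statements merged into one kernel-verified Lean document; each statement's English description precedes it below -/
import Mathlib

section
/- The identity ∑_{i=1}^n ∑_{ν∈𝒱_i} [F̂_{i,ν} : M̂] = [L̂ : K̂] holds, where for ν ∈ 𝒱_i the field F̂_{i,ν} denotes the completion of F_i with respect to ν, which is a finite extension of M̂. -/
open scoped TensorProduct


noncomputable section

/-- A sequence is Cauchy with respect to an absolute value. -/
def AbsCauchy {K : Type*} [Field K] (v : AbsoluteValue K ℝ) (s : ℕ → K) : Prop :=
  ∀ ε : ℝ, 0 < ε → ∃ N : ℕ, ∀ m ≥ N, ∀ n ≥ N, v (s m - s n) < ε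

/-- A sequence tends to a limit with respect to an absolute value. -/
def AbsTendsto {K : Type*} [Field K] (v : AbsoluteValue K ℝ) (s : ℕ → K) (a : K) : Prop :=
  ∀ ε : ℝ, 0 < ε → ∃ N : ℕ, ∀ n ≥ N, v (s n - a) < ε

/-- A field is complete with respect to an absolute value if every Cauchy sequence converges. -/
def AbsComplete {K : Type*} [Field K] (v : AbsoluteValue K ℝ) : Prop :=
  ∀ s : ℕ → K, AbsCauchy v s → ∃ a : K, AbsTendsto v s a

/-- The absolute value `vB` extends the absolute value `vA` along the embedding `f`. -/
def ExtendsAV {A B : Type*} [Field A] [Field B] (vA : AbsoluteValue A ℝ)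
    (vB : AbsoluteValue B ℝ) (f : A →+* B) : Prop :=
  ∀ x : A, vB (f x) = vA x

/-- `(B, vB, f)` is a completion of `(A, vA)`:  `f` is an isometric embedding with dense
image and `B` is complete. -/
structure IsCompletion {A B : Type*} [Field A] [Field B] (vA : AbsoluteValue A ℝ)
    (vB : AbsoluteValue B ℝ) (f : A →+* B) : Prop where
  extendsAV : ExtendsAV vA vB f
  complete : AbsComplete vB
  dense : ∀ y : B, ∀ ε : ℝ, 0 < ε → ∃ x : A, vB (y - f x) < ε

/-- Pullback of an absolute value along an embedding of fields. -/
def AbsoluteValue.comapRH {A B : Type*} [Field A] [Field B]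
    (v : AbsoluteValue B ℝ) (f : A →+* B) : AbsoluteValue A ℝ where
  toFun x := v (f x)
  map_mul' x y := by simp [map_mul]
  nonneg' x := v.nonneg _
  eq_zero' x := by
    rw [map_eq_zero, map_eq_zero]
  add_le' x y := by simpa using v.add_le (f x) (f y)

open Filter Topology in
/-- The smoothing of a ring seminorm is subadditive, also in the archimedean case. -/
theorem smoothingFun_add_le {R : Type*} [CommRing R] (μ : RingSeminorm R) (hμ1 : μ 1 ≤ 1)
    (x y : R) : smoothingFun μ (x + y) ≤ smoothingFun μ x + smoothingFun μ y := by
  have bound : ∀ (z : R) (a : ℝ), smoothingFun μ z < a →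
      ∃ C : ℝ, 0 < C ∧ ∀ k : ℕ, μ (z ^ k) ≤ C * a ^ k := by
    intro z a ha
    have ha0 : 0 < a := (smoothingFun_nonneg μ hμ1 z).trans_lt ha
    have ev := (tendsto_smoothingFun_of_map_one_le_one μ hμ1 z).eventually_lt_const ha
    obtain ⟨N, hN⟩ := eventually_atTop.1 ev
    refine ⟨1 + ∑ j ∈ Finset.range (N + 1), μ (z ^ j) / a ^ j,
      add_pos_of_pos_of_nonneg one_pos (Finset.sum_nonneg fun j _ => by positivity), fun k => ?_⟩
    have hak : 0 < a ^ k := pow_pos ha0 k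
    rw [← div_le_iff₀ hak]
    rcases le_or_gt k N with h | h
    · have := Finset.single_le_sum (f := fun j => μ (z ^ j) / a ^ j)
        (fun j _ => by positivity) (Finset.mem_range.2 (Nat.lt_succ_of_le h))
      linarith
    · have hk : (k : ℝ) ≠ 0 := by
        have : k ≠ 0 := by omega
        exact_mod_cast this
      have h1 : μ (z ^ k) ^ (1 / (k : ℝ)) < a := hN k h.le
      have h2 : μ (z ^ k) ≤ a ^ k := by
        have := pow_le_pow_left₀ (by positivity) h1.le k
        rwa [one_div, Real.rpow_inv_natCast_pow (apply_nonneg _ _) (by exact_mod_cast hk)] at this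
      have h3 : μ (z ^ k) / a ^ k ≤ 1 := (div_le_one hak).2 h2
      have : 0 ≤ ∑ j ∈ Finset.range (N + 1), μ (z ^ j) / a ^ j :=
        Finset.sum_nonneg fun j _ => by positivity
      linarith
  have natCast_mul_le : ∀ (n : ℕ) (z : R), μ (n * z) ≤ n * μ z := by
    intro n z
    induction n with
    | zero => simp
    | succ n ih =>
      push_cast
      rw [add_mul, add_mul, one_mul, one_mul]
      exact (map_add_le_add μ _ _).trans (by linarith)
  refine le_of_forall_pos_le_add fun ε hε => ?_
  obtain ⟨C, hC, hCx⟩ := bound x (smoothingFun μ x + ε / 2) (by linarith)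
  obtain ⟨D, hD, hDy⟩ := bound y (smoothingFun μ y + ε / 2) (by linarith)
  set a := smoothingFun μ x + ε / 2 with ha
  set b := smoothingFun μ y + ε / 2 with hb
  have ha0 : 0 < a := by have := smoothingFun_nonneg μ hμ1 x; linarith
  have hb0 : 0 < b := by have := smoothingFun_nonneg μ hμ1 y; linarith
  have key : ∀ n : ℕ, μ ((x + y) ^ n) ≤ C * D * (a + b) ^ n := by
    intro n
    rw [add_pow, add_pow, Finset.mul_sum]
    refine (Finset.le_sum_of_subadditive μ (map_zero μ).le (map_add_le_add μ) _ _).trans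
      (Finset.sum_le_sum fun k _ => ?_)
    rw [mul_comm _ ((n.choose k : ℕ) : R)]
    refine (natCast_mul_le _ _).trans ?_
    have : μ (x ^ k * y ^ (n - k)) ≤ (C * a ^ k) * (D * b ^ (n - k)) :=
      (map_mul_le_mul μ _ _).trans
        (mul_le_mul (hCx k) (hDy _) (apply_nonneg _ _) (by positivity))
    calc (n.choose k : ℝ) * μ (x ^ k * y ^ (n - k))
        ≤ n.choose k * ((C * a ^ k) * (D * b ^ (n - k))) := by gcongr
      _ = _ := by ring
  have lim : Tendsto (fun n : ℕ => (C * D) ^ (1 / (n : ℝ)) * (a + b)) atTop (𝓝 (1 * (a + b))) := by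
    refine Tendsto.mul_const _ ?_
    have h0 : Tendsto (fun n : ℕ => 1 / (n : ℝ)) atTop (𝓝 0) := tendsto_one_div_atTop_nhds_zero_nat
    simpa using (tendsto_const_nhds (x := C * D)).rpow h0 (Or.inl (by positivity))
  have := le_of_tendsto_of_tendsto (tendsto_smoothingFun_of_map_one_le_one μ hμ1 (x + y)) lim ?_
  · linarith
  · filter_upwards [eventually_ge_atTop 1] with n hn
    have hn0 : n ≠ 0 := by omega
    calc μ ((x + y) ^ n) ^ (1 / (n : ℝ)) ≤ (C * D * (a + b) ^ n) ^ (1 / (n : ℝ)) :=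
          Real.rpow_le_rpow (apply_nonneg _ _) (key n) (by positivity)
      _ = (C * D) ^ (1 / (n : ℝ)) * (a + b) := by
          rw [Real.mul_rpow (by positivity) (by positivity), one_div,
            Real.pow_rpow_inv_natCast (by positivity) hn0]

/-- The smoothing of a ring seminorm is submultiplicative. -/
theorem smoothingFun_mul_le {R : Type*} [CommRing R] (μ : RingSeminorm R) (hμ1 : μ 1 ≤ 1)
    (x y : R) : smoothingFun μ (x * y) ≤ smoothingFun μ x * smoothingFun μ y := by
  refine le_of_tendsto_of_tendsto' (tendsto_smoothingFun_of_map_one_le_one μ hμ1 (x * y))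
    ((tendsto_smoothingFun_of_map_one_le_one μ hμ1 x).mul
      (tendsto_smoothingFun_of_map_one_le_one μ hμ1 y)) fun n => ?_
  simp only [smoothingSeminormSeq]
  rw [← Real.mul_rpow (apply_nonneg _ _) (apply_nonneg _ _), mul_pow]
  exact Real.rpow_le_rpow (apply_nonneg _ _) (map_mul_le_mul μ _ _) (by positivity)

/-- The smoothing of a ring seminorm, as a ring seminorm. -/
def smoothingRingSeminorm {R : Type*} [CommRing R] (μ : RingSeminorm R) (hμ1 : μ 1 ≤ 1) :
    RingSeminorm R where
  toFun := smoothingFun μ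
  map_zero' := le_antisymm ((smoothingFun_le_self μ 0).trans_eq (map_zero μ))
    (smoothingFun_nonneg μ hμ1 0)
  add_le' := smoothingFun_add_le μ hμ1
  neg' x := by
    have : ∀ n : ℕ, μ ((-x) ^ n) = μ (x ^ n) := fun n => by
      rcases n.even_or_odd with h | h <;> simp [h.neg_pow]
    simp [smoothingFun, this]
  mul_le' := smoothingFun_mul_le μ hμ1

/-- A lower bound of a nonempty chain of unital ring seminorms. -/
theorem RingSeminorm.exists_le_of_isChain {R : Type*} [CommRing R] (c : Set (RingSeminorm R))
    (hne : c.Nonempty) (hone : ∀ p ∈ c, p 1 = 1)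
    (hc : ∀ p ∈ c, ∀ q ∈ c, (∀ x, p x ≤ q x) ∨ ∀ x, q x ≤ p x) :
    ∃ q : RingSeminorm R, q 1 = 1 ∧ ∀ p ∈ c, ∀ x, q x ≤ p x := by
  have : Nonempty c := hne.to_subtype
  have bdd : ∀ x, BddBelow (Set.range fun p : c => p.1 x) := fun x =>
    ⟨0, by rintro _ ⟨p, rfl⟩; exact apply_nonneg _ _⟩
  have nonneg : ∀ x, 0 ≤ ⨅ p : c, p.1 x := fun x => le_ciInf fun p => apply_nonneg _ _
  have common : ∀ p q : c, ∃ r : c, ∀ x, r.1 x ≤ p.1 x ∧ r.1 x ≤ q.1 x := fun p q => by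
    rcases hc p.1 p.2 q.1 q.2 with h | h
    · exact ⟨p, fun x => ⟨le_rfl, h x⟩⟩
    · exact ⟨q, fun x => ⟨h x, le_rfl⟩⟩
  refine ⟨{ toFun := fun x => ⨅ p : c, p.1 x
            map_zero' := by simp
            neg' := fun x => by simp
            add_le' := fun x y => ?_
            mul_le' := fun x y => ?_ }, ?_, fun p hp x => ciInf_le (bdd x) ⟨p, hp⟩⟩
  · refine le_ciInf_add_ciInf fun p q => ?_
    obtain ⟨r, hr⟩ := common p q
    exact (ciInf_le (bdd _) r).trans
      ((map_add_le_add r.1 x y).trans (add_le_add (hr x).1 (hr y).2))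
  · rw [Real.iInf_mul_of_nonneg (nonneg y)]
    refine le_ciInf fun p => ?_
    rw [Real.mul_iInf_of_nonneg (apply_nonneg _ _)]
    refine le_ciInf fun q => ?_
    obtain ⟨r, hr⟩ := common p q
    exact (ciInf_le (bdd _) r).trans ((map_mul_le_mul r.1 x y).trans
      (mul_le_mul (hr x).1 (hr y).2 (apply_nonneg _ _) (apply_nonneg _ _)))
  · change ⨅ p : c, p.1 1 = 1
    simp [hone]

/-- Every unital ring seminorm on a field dominates an absolute value. -/
theorem RingSeminorm.exists_absoluteValue_le {E : Type*} [Field E] (p : RingSeminorm E)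
    (hp : p 1 = 1) : ∃ u : AbsoluteValue E ℝ, ∀ x, u x ≤ p x := by
  let S : Set (E → ℝ)ᵒᵈ := {f | ∃ q : RingSeminorm E, q 1 = 1 ∧ ⇑q = OrderDual.ofDual f}
  obtain ⟨f, hpf, ⟨q, hq1, rfl⟩, hmin⟩ := zorn_le_nonempty₀ S (fun c hcS hc f hf => by
    obtain ⟨q, hq1, hq⟩ := RingSeminorm.exists_le_of_isChain
      {q : RingSeminorm E | q 1 = 1 ∧ OrderDual.toDual (⇑q) ∈ c}
      (by obtain ⟨q, hq, rfl⟩ := hcS hf; exact ⟨q, hq, hf⟩) (fun q hq => hq.1)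
      (fun q hq r hr => (hc.total hq.2 hr.2).symm)
    refine ⟨OrderDual.toDual ⇑q, ⟨q, hq1, rfl⟩, fun g hg => ?_⟩
    obtain ⟨r, hr, rfl⟩ := hcS hg
    exact fun x => hq r ⟨hr, hg⟩ x) (OrderDual.toDual ⇑p) ⟨p, hp, rfl⟩
  replace hmin : ∀ r : RingSeminorm E, r 1 = 1 → (∀ x, r x ≤ q x) → ∀ x, r x = q x :=
    fun r hr hle x => le_antisymm (hle x) (hmin (y := OrderDual.toDual ⇑r) ⟨r, hr, rfl⟩ hle x)
  have hpow : IsPowMul q := by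
    have hs : smoothingRingSeminorm q hq1.le 1 = 1 :=
      (smoothingFun_of_powMul q hq1.le (x := 1) (by simp [hq1])).trans hq1
    have := hmin _ hs (smoothingFun_le_self q)
    intro x n hn
    refine (this _).symm.trans (Eq.trans ?_ (congrArg (· ^ n) (this x)))
    exact isPowMul_smoothingFun q hq1.le x hn
  have hne : ∀ c : E, c ≠ 0 → q c ≠ 0 := fun c hc h => by
    have := map_mul_le_mul q c c⁻¹
    rw [mul_inv_cancel₀ hc, hq1, h, zero_mul] at this
    linarith
  have hmul : ∀ c x : E, q (c * x) = q c * q x := fun c x => by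
    rcases eq_or_ne c 0 with rfl | hc
    · simp
    have := hmin (seminormFromConst hq1.le (hne c hc) hpow)
      (seminormFromConst_one hq1.le (hne c hc) hpow)
      (seminormFromConst_le_seminorm hq1.le (hne c hc) hpow)
    have h2 := seminormFromConst_const_mul hq1.le (hne c hc) hpow x
    have h3 : ∀ x, seminormFromConst' c q x = q x := this
    simpa only [h3] using h2
  exact ⟨{ toFun := q
           map_mul' := hmul
           nonneg' := apply_nonneg q
           eq_zero' := fun x => ⟨fun h => by_contra fun hx => hne x hx h, fun h => by simp [h]⟩
           add_le' := map_add_le_add q }, hpf⟩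

open scoped Matrix.Norms.Operator in
/-- An absolute value extends to any finite field extension. -/
theorem exists_extendsAV {k E : Type*} [Field k] [Field E] [Algebra k E] [FiniteDimensional k E]
    (v : AbsoluteValue k ℝ) : ∃ u : AbsoluteValue E ℝ, ExtendsAV v u (algebraMap k E) := by
  let _ := v.toNormedField
  have : Nonempty (Fin (Module.finrank k E)) := Fin.pos_iff_nonempty.1 Module.finrank_pos
  let b := Module.finBasis k E
  let p : RingSeminorm E :=
    { toFun := fun x => ‖Algebra.leftMulMatrix b x‖
      map_zero' := by simp
      add_le' := fun x y => by rw [map_add]; exact norm_add_le _ _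
      neg' := fun x => by rw [map_neg, norm_neg]
      mul_le' := fun x y => by rw [map_mul]; exact norm_mul_le _ _ }
  have hpk : ∀ a : k, p (algebraMap k E a) = v a := fun a => by
    change ‖Algebra.leftMulMatrix b (algebraMap k E a)‖ = ‖a‖
    rw [AlgHom.commutes, Matrix.algebraMap_eq_diagonal, Matrix.linfty_opNorm_diagonal]
    exact pi_norm_const a
  obtain ⟨u, hu⟩ := p.exists_absoluteValue_le (by simpa using hpk 1)
  have hle : ∀ a : k, u (algebraMap k E a) ≤ v a := fun a => (hu _).trans_eq (hpk a)
  refine ⟨u, fun a => (hle a).antisymm ?_⟩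
  rcases eq_or_ne a 0 with rfl | ha
  · simp
  have := hle a⁻¹
  rw [map_inv₀, map_inv₀, map_inv₀] at this
  exact (inv_le_inv₀ (u.pos (by simpa using ha)) (v.pos ha)).1 this

/-- Coordinates with respect to a linearly independent family are bounded, over a complete
field. -/
theorem exists_coord_le {k B : Type*} [Field k] [Field B] [Algebra k B]
    {v : AbsoluteValue k ℝ} {w : AbsoluteValue B ℝ} (hv : AbsComplete v)
    (hw : ExtendsAV v w (algebraMap k B)) (n : ℕ) (b : Fin n → B) (hb : LinearIndependent k b) :
    ∃ C : ℝ, 0 < C ∧ ∀ (c : Fin n → k) (i : Fin n), v (c i) ≤ C * w (∑ i, c i • b i) := by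
  have hsmul : ∀ (a : k) (x : B), w (a • x) = v a * w x := fun a x => by
    rw [Algebra.smul_def, map_mul, hw]
  induction n with
  | zero => exact ⟨1, one_pos, fun c i => i.elim0⟩
  | succ n ih =>
    obtain ⟨C, hC, h⟩ := ih (fun i => b i.castSucc) (hb.comp _ (Fin.castSucc_injective n))
    set x := b (Fin.last n) with hx
    obtain ⟨δ, hδ, hdist⟩ : ∃ δ : ℝ, 0 < δ ∧
        ∀ c : Fin n → k, δ ≤ w (x - ∑ i, c i • b i.castSucc) := by
      by_contra! hcon
      choose c hc using fun j : ℕ => hcon (1 / ((j : ℝ) + 1)) (by positivity)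
      have hcauchy : ∀ i, AbsCauchy v fun j => c j i := fun i ε hε => by
        obtain ⟨N, hN⟩ := exists_nat_one_div_lt (show 0 < ε / (2 * C) by positivity)
        refine ⟨N, fun p hp q hq => ?_⟩
        have hlt : ∀ p ≥ N, w (x - ∑ i, c p i • b i.castSucc) < ε / (2 * C) := fun p hp =>
          (hc p).trans_le ((one_div_le_one_div_of_le (by positivity)
            (by have : (N : ℝ) ≤ p := by exact_mod_cast hp
                linarith)).trans hN.le)
        have hpq := h (fun i => c p i - c q i) i
        have heq : ∑ i, (c p i - c q i) • b i.castSucc =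
            (x - ∑ i, c q i • b i.castSucc) - (x - ∑ i, c p i • b i.castSucc) := by
          simp only [sub_smul, Finset.sum_sub_distrib]; ring
        rw [heq] at hpq
        calc v (c p i - c q i) ≤ _ := hpq
          _ ≤ C * (w (x - ∑ i, c q i • b i.castSucc) + w (x - ∑ i, c p i • b i.castSucc)) := by
            gcongr
            have := w.add_le (x - ∑ i, c q i • b i.castSucc) (-(x - ∑ i, c p i • b i.castSucc))
            rwa [w.map_neg, ← sub_eq_add_neg] at this
          _ < C * (ε / (2 * C) + ε / (2 * C)) := by
            gcongr
            exacts [hlt q hq, hlt p hp]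
          _ = ε := by field_simp; ring
      choose d hd using fun i => hv _ (hcauchy i)
      have hzero : x - ∑ i, d i • b i.castSucc = 0 := by
        rw [← w.eq_zero]
        refine le_antisymm (le_of_forall_pos_le_add fun ε hε => ?_) (w.nonneg _)
        let T := ∑ i : Fin n, w (b i.castSucc)
        have hT : 0 ≤ T := Finset.sum_nonneg fun i _ => w.nonneg _
        obtain ⟨N, hN⟩ := exists_nat_one_div_lt (half_pos hε)
        choose M hM using fun i => hd i (ε / (2 * (T + 1))) (by positivity)
        let J := max N (Finset.univ.sup M)
        have h1 : w (x - ∑ i, c J i • b i.castSucc) ≤ ε / 2 :=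
          (hc J).le.trans ((one_div_le_one_div_of_le (by positivity)
            (by have : (N : ℝ) ≤ J := by exact_mod_cast le_max_left _ _
                linarith)).trans hN.le)
        have h2 : w (∑ i, (c J i - d i) • b i.castSucc) ≤ ε / 2 := by
          calc w (∑ i, (c J i - d i) • b i.castSucc)
              ≤ ∑ i, w ((c J i - d i) • b i.castSucc) := w.sum_le _ _
            _ ≤ ∑ i : Fin n, ε / (2 * (T + 1)) * w (b i.castSucc) := by
              refine Finset.sum_le_sum fun i _ => ?_
              rw [hsmul]
              exact mul_le_mul_of_nonneg_right (hM i J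
                ((Finset.le_sup (Finset.mem_univ i)).trans (le_max_right _ _))).le (w.nonneg _)
            _ = ε / 2 * (T / (T + 1)) := by rw [← Finset.mul_sum]; field_simp; rfl
            _ ≤ ε / 2 * 1 := by
              gcongr
              rw [div_le_one (by positivity)]
              linarith
            _ = ε / 2 := mul_one _
        have heq : x - ∑ i, d i • b i.castSucc =
            (x - ∑ i, c J i • b i.castSucc) + ∑ i, (c J i - d i) • b i.castSucc := by
          simp only [sub_smul, Finset.sum_sub_distrib]; ring
        rw [heq]
        have := w.add_le (x - ∑ i, c J i • b i.castSucc) (∑ i, (c J i - d i) • b i.castSucc)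
        linarith
      have := Fintype.linearIndependent_iff.1 hb
        (Fin.snoc (α := fun _ => k) (fun i => -d i) 1) (by
          rw [Fin.sum_univ_castSucc]
          simp only [Fin.snoc_castSucc, Fin.snoc_last, neg_smul, one_smul,
            Finset.sum_neg_distrib]
          rw [← hx, ← hzero]; ring) (Fin.last n)
      simp at this
    refine ⟨max δ⁻¹ (C * (1 + δ⁻¹ * w x)), by positivity, fun c i => ?_⟩
    set y := ∑ i, c i • b i with hy
    have hysum : y = ∑ i : Fin n, c i.castSucc • b i.castSucc + c (Fin.last n) • x :=
      Fin.sum_univ_castSucc _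
    have hlast : v (c (Fin.last n)) ≤ δ⁻¹ * w y := by
      rcases eq_or_ne (c (Fin.last n)) 0 with h0 | h0
      · rw [h0, map_zero]; positivity
      have h1 := hdist fun i => -((c (Fin.last n))⁻¹ * c i.castSucc)
      have h2 : y = c (Fin.last n) •
          (x - ∑ i : Fin n, (-((c (Fin.last n))⁻¹ * c i.castSucc)) • b i.castSucc) := by
        simp only [neg_smul, mul_smul, Finset.sum_neg_distrib, sub_neg_eq_add, smul_add,
          ← Finset.smul_sum]
        rw [smul_inv_smul₀ h0, hysum, add_comm]
      rw [h2, hsmul, ← div_eq_inv_mul, le_div_iff₀ hδ]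
      gcongr
    induction i using Fin.lastCases with
    | last => exact hlast.trans (mul_le_mul_of_nonneg_right (le_max_left _ _) (w.nonneg _))
    | cast i =>
      refine le_trans ?_ (mul_le_mul_of_nonneg_right (le_max_right _ _) (w.nonneg _))
      have h1 := h (fun i => c i.castSucc) i
      have h2 : ∑ i : Fin n, c i.castSucc • b i.castSucc = y + -(c (Fin.last n) • x) := by
        rw [hysum]; ring
      have h3 := w.add_le y (-(c (Fin.last n) • x))
      rw [w.map_neg, hsmul, ← h2] at h3
      calc v (c i.castSucc) ≤ _ := h1
        _ ≤ C * (w y + δ⁻¹ * w y * w x) := by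
          gcongr
          exact h3.trans (by gcongr)
        _ = _ := by ring

/-- A dense finite-dimensional subspace over a complete field is everything. -/
theorem Submodule.eq_top_of_dense {k B : Type*} [Field k] [Field B] [Algebra k B]
    {v : AbsoluteValue k ℝ} {w : AbsoluteValue B ℝ} (hv : AbsComplete v)
    (hw : ExtendsAV v w (algebraMap k B)) (S : Submodule k B) [FiniteDimensional k S]
    (hS : ∀ (y : B) (ε : ℝ), 0 < ε → ∃ x ∈ S, w (y - x) < ε) : S = ⊤ := by
  by_contra hne
  obtain ⟨y, -, hy⟩ := SetLike.exists_of_lt (lt_top_iff_ne_top.2 hne)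
  let b := Module.finBasis k S
  have hbS : Submodule.span k (Set.range fun i => (b i : B)) = S := by
    have := congrArg (Submodule.map S.subtype) b.span_eq
    rw [Submodule.map_span, ← Set.range_comp, Submodule.map_top, Submodule.range_subtype] at this
    exact this
  have hli : LinearIndependent k (Fin.snoc (α := fun _ => B) (fun i => (b i : B)) y) :=
    linearIndependent_finSnoc.2
      ⟨b.linearIndependent.map' S.subtype S.ker_subtype, by rwa [hbS]⟩
  obtain ⟨C, hC, h⟩ := exists_coord_le hv hw _ _ hli
  obtain ⟨x, hx, hxy⟩ := hS y C⁻¹ (by positivity)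
  have h1 := h (Fin.snoc (α := fun _ => k) (fun i => -b.repr ⟨x, hx⟩ i) 1) (Fin.last _)
  rw [Fin.sum_univ_castSucc] at h1
  simp only [Fin.snoc_castSucc, Fin.snoc_last, neg_smul, one_smul, Finset.sum_neg_distrib,
    map_one] at h1
  have h2 : ∑ i, b.repr ⟨x, hx⟩ i • (b i : B) = x := by
    simpa only [map_sum, map_smul, Submodule.subtype_apply] using
      congrArg S.subtype (b.sum_repr ⟨x, hx⟩)
  rw [h2, neg_add_eq_sub] at h1
  have : C * w (y - x) < C * C⁻¹ := by gcongr
  rw [mul_inv_cancel₀ hC.ne'] at this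
  linarith

/-- Extensions of the absolute value of a complete field to a finite extension are unique. -/
theorem ExtendsAV.unique {k B : Type*} [Field k] [Field B] [Algebra k B] [FiniteDimensional k B]
    {v : AbsoluteValue k ℝ} {w₁ w₂ : AbsoluteValue B ℝ} (hv : AbsComplete v)
    (h₁ : ExtendsAV v w₁ (algebraMap k B)) (h₂ : ExtendsAV v w₂ (algebraMap k B)) : w₁ = w₂ := by
  suffices H : ∀ w₁ w₂ : AbsoluteValue B ℝ, ExtendsAV v w₁ (algebraMap k B) →
      ExtendsAV v w₂ (algebraMap k B) → ∀ x, w₁ x ≤ w₂ x from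
    AbsoluteValue.ext fun x => (H _ _ h₁ h₂ x).antisymm (H _ _ h₂ h₁ x)
  intro w₁ w₂ h₁ h₂ x
  let b := Module.finBasis k B
  obtain ⟨C, hC, h⟩ := exists_coord_le hv h₂ _ _ b.linearIndependent
  have bound : ∀ y, w₁ y ≤ (∑ i, C * w₁ (b i)) * w₂ y := fun y => by
    have hy := h (b.repr y)
    rw [b.sum_repr] at hy
    conv_lhs => rw [← b.sum_repr y]
    rw [Finset.sum_mul]
    refine (w₁.sum_le _ _).trans (Finset.sum_le_sum fun i _ => ?_)
    rw [Algebra.smul_def, map_mul, h₁]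
    exact (mul_le_mul_of_nonneg_right (hy i) (w₁.nonneg _)).trans_eq (by ring)
  by_contra! hlt
  have hx : 0 < w₂ x := w₂.pos fun hx => by simp [hx] at hlt
  obtain ⟨n, hn⟩ := pow_unbounded_of_one_lt (∑ i, C * w₁ (b i)) ((one_lt_div hx).2 hlt)
  have := bound (x ^ n)
  rw [map_pow, map_pow, ← div_le_iff₀ (by positivity), ← div_pow] at this
  linarith

/-- A field homomorphism preserving absolute values is determined on a completion by its
restriction to the dense subfield. -/
theorem IsCompletion.hom_ext {A B C : Type*} [Field A] [Field B] [Field C]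
    {vA : AbsoluteValue A ℝ} {vB : AbsoluteValue B ℝ} {vC : AbsoluteValue C ℝ} {f : A →+* B}
    (hf : IsCompletion vA vB f) {g h : B →+* C} (hg : ExtendsAV vB vC g) (hh : ExtendsAV vB vC h)
    (hgh : ∀ a, g (f a) = h (f a)) : g = h := by
  ext y
  rw [← sub_eq_zero, ← vC.eq_zero]
  refine le_antisymm (le_of_forall_pos_le_add fun ε hε => ?_) (vC.nonneg _)
  obtain ⟨x, hx⟩ := hf.dense y (ε / 2) (half_pos hε)
  have h1 : g y - h y = g (y - f x) + -h (y - f x) := by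
    rw [map_sub, map_sub, hgh]; ring
  have h2 := vC.add_le (g (y - f x)) (-h (y - f x))
  rw [h1]
  rw [vC.map_neg, hg, hh] at h2
  linarith

/-- Embeddings into complete fields extend to completions. -/
theorem IsCompletion.exists_lift {A B C : Type*} [Field A] [Field B] [Field C]
    {vA : AbsoluteValue A ℝ} {vB : AbsoluteValue B ℝ} {vC : AbsoluteValue C ℝ} {f : A →+* B}
    (hf : IsCompletion vA vB f) {g : A →+* C} (hg : ExtendsAV vA vC g) (hC : AbsComplete vC) :
    ∃ h : B →+* C, (∀ a, h (f a) = g a) ∧ ExtendsAV vB vC h := by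
  let _ := vA.toNormedField
  let _ := vB.toNormedField
  let _ := vC.toNormedField
  have : CompleteSpace C := Metric.complete_of_cauchySeq_tendsto fun s hs => by
    simp only [Metric.cauchySeq_iff, dist_eq_norm] at hs
    obtain ⟨a, ha⟩ := hC s hs
    refine ⟨a, Metric.tendsto_atTop.2 ?_⟩
    simp only [dist_eq_norm]
    exact ha
  have hfi : Isometry f := AddMonoidHomClass.isometry_of_norm f hf.extendsAV
  have hgi : Isometry g := AddMonoidHomClass.isometry_of_norm g hg
  have hd : DenseRange f := Metric.denseRange_iff.2 fun y ε hε => by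
    simp only [dist_eq_norm]
    exact hf.dense y ε hε
  let h : B →+* C :=
    IsDenseInducing.extendRingHom hfi.isUniformInducing hd hgi.uniformContinuous
  have hfg : ∀ a, h (f a) = g a := fun a =>
    (hfi.isUniformInducing.isDenseInducing hd).extend_eq hgi.continuous a
  have hcont : Continuous h := (uniformContinuous_uniformly_extend hfi.isUniformInducing hd
    hgi.uniformContinuous).continuous
  refine ⟨h, hfg, fun y => ?_⟩
  refine hd.induction_on (p := fun y => ‖h y‖ = ‖y‖) y
    (isClosed_eq hcont.norm continuous_norm) fun a => ?_
  rw [hfg]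
  exact (hg a).trans (hf.extendsAV a).symm

/-- A finite extension generates its completion over the completed base field. -/
theorem span_range_algebraMap_eq_top_of_isCompletion
    (K : Type*) {L Kh Lh : Type*} [Field K] [Field L] [Algebra K L] [FiniteDimensional K L]
    [Field Kh] [Field Lh] [Algebra K Kh] [Algebra L Lh] [Algebra Kh Lh]
    [Algebra K Lh] [IsScalarTower K Kh Lh] [IsScalarTower K L Lh]
    {vL : AbsoluteValue L ℝ} {vKh : AbsoluteValue Kh ℝ} {vLh : AbsoluteValue Lh ℝ}
    (hKh : AbsComplete vKh)
    (hLh : IsCompletion vL vLh (algebraMap L Lh)) (hKhLh : ExtendsAV vKh vLh (algebraMap Kh Lh)) :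
    FiniteDimensional Kh Lh ∧ Submodule.span Kh (Set.range (algebraMap L Lh)) = ⊤ := by
  let b := Module.finBasis K L
  set S := Submodule.span Kh (Set.range fun i => algebraMap L Lh (b i)) with hS
  have hmem : ∀ l, algebraMap L Lh l ∈ S := fun l => by
    rw [← b.sum_repr l, map_sum]
    refine Submodule.sum_mem _ fun i _ => ?_
    rw [Algebra.algebraMap_eq_smul_one, smul_assoc, ← algebraMap_smul Kh,
      ← Algebra.algebraMap_eq_smul_one]
    exact Submodule.smul_mem _ _ (Submodule.subset_span ⟨i, rfl⟩)
  have : FiniteDimensional Kh S := FiniteDimensional.span_of_finite _ (Set.finite_range _)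
  have htop : S = ⊤ := Submodule.eq_top_of_dense hKh hKhLh S fun y ε hε => by
    obtain ⟨l, hl⟩ := hLh.dense y ε hε
    exact ⟨_, hmem l, hl⟩
  refine ⟨?_, top_le_iff.1 (htop ▸ Submodule.span_le.2 ?_)⟩
  · rw [htop] at this
    exact Module.Finite.equiv Submodule.topEquiv
  · rintro _ ⟨i, rfl⟩
    exact Submodule.subset_span ⟨_, rfl⟩

/-- The completion of a finite separable extension is separable. -/
theorem isSeparable_of_isCompletion
    (K : Type*) {L Kh Lh : Type*} [Field K] [Field L] [Algebra K L] [FiniteDimensional K L]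
    [Algebra.IsSeparable K L] [Field Kh] [Field Lh] [Algebra K Kh] [Algebra L Lh] [Algebra Kh Lh]
    [Algebra K Lh] [IsScalarTower K Kh Lh] [IsScalarTower K L Lh]
    {vL : AbsoluteValue L ℝ} {vKh : AbsoluteValue Kh ℝ} {vLh : AbsoluteValue Lh ℝ}
    (hKh : AbsComplete vKh)
    (hLh : IsCompletion vL vLh (algebraMap L Lh)) (hKhLh : ExtendsAV vKh vLh (algebraMap Kh Lh)) :
    Algebra.IsSeparable Kh Lh := by
  have hspan := (span_range_algebraMap_eq_top_of_isCompletion K hKh hLh hKhLh).2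
  have htop : IntermediateField.adjoin Kh (Set.range (algebraMap L Lh)) = ⊤ :=
    top_le_iff.1 fun x _ => by
      have hx : x ∈ Submodule.span Kh (Set.range (algebraMap L Lh)) := hspan ▸ Submodule.mem_top
      exact (Submodule.span_le (p := (IntermediateField.adjoin Kh
        (Set.range (algebraMap L Lh))).toSubalgebra.toSubmodule)).2
          (IntermediateField.subset_adjoin _ _) hx
  have : Algebra.IsSeparable Kh (IntermediateField.adjoin Kh (Set.range (algebraMap L Lh))) := by
    rw [IntermediateField.isSeparable_adjoin_iff_isSeparable]
    rintro _ ⟨l, rfl⟩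
    have : IsSeparable K (algebraMap L Lh l) :=
      (Algebra.IsSeparable.isSeparable K l).map (f := IsScalarTower.toAlgHom K L Lh)
        (algebraMap L Lh).injective
    exact this.tower_top Kh
  rw [htop] at this
  exact Algebra.IsSeparable.of_algHom Kh _ IntermediateField.topEquiv.symm.toAlgHom

/-- A ring homomorphism from a finite product of fields to a field factors through a
projection. -/
theorem exists_factor_pi {ι E : Type*} [Finite ι] {F : ι → Type*} [∀ i, Field (F i)] [Field E]
    (ρ : (∀ i, F i) →+* E) : ∃ (i : ι) (g : F i →+* E), ∀ x, ρ x = g (x i) := by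
  classical
  have := Fintype.ofFinite ι
  obtain ⟨i, hi⟩ : ∃ i, ρ (Pi.single i 1) ≠ 0 := by
    by_contra! h
    have h1 : ρ (∑ i, Pi.single i 1) = 0 := by rw [map_sum]; exact Finset.sum_eq_zero fun i _ => h i
    rw [show ∑ i, Pi.single i (1 : F i) = 1 from Finset.univ_sum_single 1, map_one] at h1
    exact one_ne_zero h1
  have hi1 : ρ (Pi.single i 1) = 1 := by
    refine mul_left_cancel₀ hi ?_
    rw [← map_mul, ← Pi.single_mul, one_mul, mul_one]
  refine ⟨i, { toFun := fun x => ρ (Pi.single i x)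
               map_one' := hi1
               map_zero' := by simp
               map_add' := fun x y => by rw [Pi.single_add, map_add]
               map_mul' := fun x y => by rw [Pi.single_mul, map_mul] }, fun x => ?_⟩
  calc ρ x = ρ (x * Pi.single i 1) := by rw [map_mul, hi1, mul_one]
    _ = ρ (Pi.single i (x i)) := by
      congr 1
      ext j
      rcases eq_or_ne j i with rfl | hj <;> simp [*]

/-- The degree of a finite reduced algebra over a field is the sum of its residue degrees. -/
theorem finrank_eq_sum_maximalSpectrum {k A : Type*} [Field k] [CommRing A] [Algebra k A]
    [Module.Finite k A] [IsReduced A] [Fintype (MaximalSpectrum A)] :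
    Module.finrank k A = ∑ m : MaximalSpectrum A, Module.finrank k (A ⧸ m.asIdeal) := by
  have : IsArtinianRing A := IsArtinianRing.of_finite k A
  rw [((IsArtinianRing.equivPi A).restrictScalars k).toLinearEquiv.finrank_eq,
    Module.finrank_pi_fintype]

section TensorProduct

variable {K L M Kh Lh Mh : Type*} [Field K] [Field L] [Field M] [Algebra K L] [Algebra K M]
  [Field Kh] [Field Lh] [Field Mh] [Algebra L Lh] [Algebra M Mh] [Algebra Kh Lh] [Algebra Kh Mh]

/-- Two absolute values on quotients of the tensor product of completions agree if they agree on
the dense image of the uncompleted tensor product. -/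
theorem absoluteValue_eq_of_tensorProduct {B₁ B₂ : Type*} [Field B₁] [Field B₂]
    {vL : AbsoluteValue L ℝ} {vM : AbsoluteValue M ℝ}
    {vLh : AbsoluteValue Lh ℝ} {vMh : AbsoluteValue Mh ℝ}
    {u₁ : AbsoluteValue B₁ ℝ} {u₂ : AbsoluteValue B₂ ℝ}
    (hLh : IsCompletion vL vLh (algebraMap L Lh)) (hMh : IsCompletion vM vMh (algebraMap M Mh))
    {τ : L ⊗[K] M →+* Mh ⊗[Kh] Lh}
    (hτ : ∀ l m, τ (l ⊗ₜ m) = algebraMap M Mh m ⊗ₜ algebraMap L Lh l)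
    {φ₁ : Mh ⊗[Kh] Lh →+* B₁} {φ₂ : Mh ⊗[Kh] Lh →+* B₂}
    (h₁ : ∀ m l, u₁ (φ₁ (m ⊗ₜ l)) = vMh m * vLh l) (h₂ : ∀ m l, u₂ (φ₂ (m ⊗ₜ l)) = vMh m * vLh l)
    (heq : ∀ t, u₁ (φ₁ (τ t)) = u₂ (φ₂ (τ t))) (a : Mh ⊗[Kh] Lh) : u₁ (φ₁ a) = u₂ (φ₂ a) := by
  have approx : ∀ ε : ℝ, 0 < ε → ∃ t, u₁ (φ₁ (a - τ t)) < ε ∧ u₂ (φ₂ (a - τ t)) < ε := by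
    induction a with
    | zero => exact fun ε hε => ⟨0, by simpa using hε⟩
    | add a b ha hb =>
      intro ε hε
      obtain ⟨s, hs₁, hs₂⟩ := ha (ε / 2) (half_pos hε)
      obtain ⟨t, ht₁, ht₂⟩ := hb (ε / 2) (half_pos hε)
      refine ⟨s + t, ?_⟩
      rw [show a + b - τ (s + t) = (a - τ s) + (b - τ t) by rw [map_add]; ring, map_add φ₁,
        map_add φ₂]
      exact ⟨(u₁.add_le _ _).trans_lt (by linarith), (u₂.add_le _ _).trans_lt (by linarith)⟩
    | tmul x y =>
      intro ε hε
      obtain ⟨m, hm⟩ := hMh.dense x (ε / (2 * (vLh y + 1))) (by positivity)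
      obtain ⟨l, hl⟩ := hLh.dense y (ε / (2 * (vMh (algebraMap M Mh m) + 1))) (by positivity)
      refine ⟨l ⊗ₜ m, ?_⟩
      have hsplit : x ⊗ₜ[Kh] y - τ (l ⊗ₜ m) =
          (x - algebraMap M Mh m) ⊗ₜ y + algebraMap M Mh m ⊗ₜ (y - algebraMap L Lh l) := by
        rw [hτ, TensorProduct.sub_tmul, TensorProduct.tmul_sub]; abel
      have b₁ : vMh (x - algebraMap M Mh m) * vLh y ≤ ε / 2 := by
        calc _ ≤ ε / (2 * (vLh y + 1)) * (vLh y + 1) := by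
              have := vLh.nonneg y
              gcongr
              linarith
          _ = ε / 2 := by field_simp
      have b₂ : vMh (algebraMap M Mh m) * vLh (y - algebraMap L Lh l) < ε / 2 := by
        calc _ ≤ vMh (algebraMap M Mh m) * (ε / (2 * (vMh (algebraMap M Mh m) + 1))) := by gcongr
          _ < (vMh (algebraMap M Mh m) + 1) * (ε / (2 * (vMh (algebraMap M Mh m) + 1))) := by
              have : 0 < ε / (2 * (vMh (algebraMap M Mh m) + 1)) := by positivity
              gcongr
              linarith
          _ = ε / 2 := by field_simp
      rw [hsplit, map_add φ₁, map_add φ₂]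
      refine ⟨(u₁.add_le _ _).trans_lt ?_, (u₂.add_le _ _).trans_lt ?_⟩
      · rw [h₁, h₁]; linarith
      · rw [h₂, h₂]; linarith
  refine eq_of_abs_sub_le_all fun ε hε => ?_
  obtain ⟨t, ht₁, ht₂⟩ := approx (ε / 2) (half_pos hε)
  rw [map_sub] at ht₁ ht₂
  have e₁ := (u₁.abs_abv_sub_le_abv_sub (φ₁ a) (φ₁ (τ t))).trans_lt ht₁
  have e₂ := (u₂.abs_abv_sub_le_abv_sub (φ₂ a) (φ₂ (τ t))).trans_lt ht₂
  rw [heq t] at e₁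
  rw [abs_lt] at e₁ e₂
  rw [abs_le]
  constructor <;> linarith

variable [Algebra K Kh] [Algebra K Lh] [Algebra K Mh]
  [IsScalarTower K Kh Lh] [IsScalarTower K L Lh] [IsScalarTower K Kh Mh] [IsScalarTower K M Mh]

variable (K L M Kh Lh Mh) in
/-- The canonical map from the tensor product to the tensor product of extension fields. -/
theorem exists_tensorProduct_ringHom : ∃ τ : L ⊗[K] M →+* Mh ⊗[Kh] Lh,
    ∀ l m, τ (l ⊗ₜ m) = algebraMap M Mh m ⊗ₜ algebraMap L Lh l := by
  have hcomm : ∀ r : K, algebraMap K Mh r ⊗ₜ[Kh] (1 : Lh) = (1 : Mh) ⊗ₜ algebraMap K Lh r :=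
    fun r => by
      rw [IsScalarTower.algebraMap_apply K Kh Mh, IsScalarTower.algebraMap_apply K Kh Lh,
        Algebra.algebraMap_eq_smul_one, TensorProduct.smul_tmul, ← Algebra.algebraMap_eq_smul_one]
  let f : L →ₐ[K] Mh ⊗[Kh] Lh :=
    { (Algebra.TensorProduct.includeRight : Lh →ₐ[Kh] Mh ⊗[Kh] Lh).toRingHom.comp
        (algebraMap L Lh) with
      commutes' := fun r => by
        change (1 : Mh) ⊗ₜ[Kh] algebraMap L Lh (algebraMap K L r) = _
        rw [← IsScalarTower.algebraMap_apply K L Lh, ← hcomm]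
        rfl }
  let g : M →ₐ[K] Mh ⊗[Kh] Lh :=
    { (Algebra.TensorProduct.includeLeftRingHom : Mh →+* Mh ⊗[Kh] Lh).comp
        (algebraMap M Mh) with
      commutes' := fun r => by
        change algebraMap M Mh (algebraMap K M r) ⊗ₜ[Kh] (1 : Lh) = _
        rw [← IsScalarTower.algebraMap_apply K M Mh]
        rfl }
  refine ⟨(Algebra.TensorProduct.lift f g fun _ _ => Commute.all _ _).toRingHom, fun l m => ?_⟩
  change Algebra.TensorProduct.lift f g _ (l ⊗ₜ m) = _
  rw [Algebra.TensorProduct.lift_tmul]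
  change ((1 : Mh) ⊗ₜ[Kh] algebraMap L Lh l) * (algebraMap M Mh m ⊗ₜ[Kh] (1 : Lh)) = _
  rw [Algebra.TensorProduct.tmul_mul_tmul, one_mul, mul_one]

/-- A completion of a compositum of `L` and `M` is a quotient of the tensor product of the
completions of `L` and `M`. -/
theorem exists_surjective_algHom_of_isCompletion [FiniteDimensional Kh Lh]
    {F Fh : Type*} [Field F] [Field Fh] [Algebra K F] [Algebra L F] [Algebra M F]
    [IsScalarTower K L F] [IsScalarTower K M F]
    [Algebra F Fh] [Algebra Mh Fh] [Algebra M Fh] [IsScalarTower M Mh Fh] [IsScalarTower M F Fh]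
    {vK : AbsoluteValue K ℝ} {vL : AbsoluteValue L ℝ}
    {vKh : AbsoluteValue Kh ℝ} {vLh : AbsoluteValue Lh ℝ} {vMh : AbsoluteValue Mh ℝ}
    {w : AbsoluteValue F ℝ} {vFh : AbsoluteValue Fh ℝ}
    (hKh : IsCompletion vK vKh (algebraMap K Kh)) (hLh : IsCompletion vL vLh (algebraMap L Lh))
    (hMh : AbsComplete vMh)
    (hKhLh : ExtendsAV vKh vLh (algebraMap Kh Lh)) (hKhMh : ExtendsAV vKh vMh (algebraMap Kh Mh))
    (π : L ⊗[K] M → F) (hπ : Function.Surjective π) (hπ_add : ∀ s t, π (s + t) = π s + π t)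
    (hπ_tmul : ∀ l m, π (l ⊗ₜ m) = algebraMap L F l * algebraMap M F m)
    (hw : ExtendsAV vL w (algebraMap L F)) (hFh : IsCompletion w vFh (algebraMap F Fh))
    (hFhM : ExtendsAV vMh vFh (algebraMap Mh Fh)) :
    ∃ φ : Mh ⊗[Kh] Lh →ₐ[Mh] Fh, Function.Surjective φ ∧
      (∀ l m, φ (algebraMap M Mh m ⊗ₜ algebraMap L Lh l) =
        algebraMap F Fh (algebraMap L F l * algebraMap M F m)) ∧
      ∀ m l, vFh (φ (m ⊗ₜ l)) = vMh m * vLh l := by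
  obtain ⟨σ, hσL, hσ⟩ := hLh.exists_lift (g := (algebraMap F Fh).comp (algebraMap L F))
    (fun l => (hFh.extendsAV _).trans (hw l)) hFh.complete
  have hKFh : σ.comp (algebraMap Kh Lh) = (algebraMap Mh Fh).comp (algebraMap Kh Mh) :=
    hKh.hom_ext (fun x => (hσ _).trans (hKhLh x)) (fun x => (hFhM _).trans (hKhMh x)) fun a => by
      simp only [RingHom.comp_apply]
      rw [← IsScalarTower.algebraMap_apply K Kh Lh, ← IsScalarTower.algebraMap_apply K Kh Mh,
        IsScalarTower.algebraMap_apply K L Lh, IsScalarTower.algebraMap_apply K M Mh, hσL,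
        ← IsScalarTower.algebraMap_apply M Mh Fh, IsScalarTower.algebraMap_apply M F Fh,
        RingHom.comp_apply, ← IsScalarTower.algebraMap_apply K L F,
        ← IsScalarTower.algebraMap_apply K M F]
  let _ : Algebra Kh Fh := ((algebraMap Mh Fh).comp (algebraMap Kh Mh)).toAlgebra
  have : IsScalarTower Kh Mh Fh := IsScalarTower.of_algebraMap_eq fun _ => rfl
  let σ' : Lh →ₐ[Kh] Fh := { σ with commutes' := fun x => congrArg (fun f => f x) hKFh }
  let φ : Mh ⊗[Kh] Lh →ₐ[Mh] Fh :=
    Algebra.TensorProduct.lift (Algebra.ofId Mh Fh) σ' fun _ _ => Commute.all _ _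
  have hφ : ∀ m l, φ (m ⊗ₜ l) = algebraMap Mh Fh m * σ l := fun m l =>
    Algebra.TensorProduct.lift_tmul _ _ _ m l
  have hφLM : ∀ l m, φ (algebraMap M Mh m ⊗ₜ algebraMap L Lh l) =
      algebraMap F Fh (algebraMap L F l * algebraMap M F m) := fun l m => by
    rw [hφ, hσL, ← IsScalarTower.algebraMap_apply M Mh Fh, IsScalarTower.algebraMap_apply M F Fh,
      RingHom.comp_apply, map_mul, mul_comm]
  refine ⟨φ, ?_, hφLM, fun m l => by rw [hφ, map_mul, hFhM, hσ]⟩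
  have hmem : ∀ t, algebraMap F Fh (π t) ∈ LinearMap.range φ.toLinearMap := fun t => by
    induction t with
    | zero =>
      have h0 : π 0 = 0 := by simpa using hπ_add 0 0
      rw [h0, map_zero]
      exact Submodule.zero_mem _
    | add s t hs ht =>
      rw [hπ_add, map_add]
      exact Submodule.add_mem _ hs ht
    | tmul l m =>
      rw [hπ_tmul]
      exact ⟨algebraMap M Mh m ⊗ₜ algebraMap L Lh l, hφLM l m⟩
  exact LinearMap.range_eq_top.1 <| Submodule.eq_top_of_dense hMh hFhM _ fun y ε hε => by
    obtain ⟨x, hx⟩ := hFh.dense y ε hε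
    obtain ⟨t, rfl⟩ := hπ x
    exact ⟨_, hmem t, hx⟩

end TensorProduct

/-- **Theorem (global), part (2).**
With `L/K` finite separable, `vL`, `vM` extending `vK`, the decomposition
`L ⊗[K] M ≃ F₁ × ⋯ × Fₙ` into fields, completions `K̂, L̂, M̂`, and, for each `i` and each
absolute value `w ∈ 𝒱ᵢ` (the set of absolute values on `Fᵢ` extending both `vL` and `vM`),
a completion `F̂_{i,w}` of `Fᵢ` at `w` which is an extension of `M̂`, one has
`∑ᵢ ∑_{w ∈ 𝒱ᵢ} [F̂_{i,w} : M̂] = [L̂ : K̂]`. -/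
theorem global_degree
    {K L M : Type*} [Field K] [Field L] [Field M]
    [Algebra K L] [Algebra K M]
    [FiniteDimensional K L] [Algebra.IsSeparable K L]
    (vK : AbsoluteValue K ℝ) (vL : AbsoluteValue L ℝ) (vM : AbsoluteValue M ℝ)
    (hvL : ExtendsAV vK vL (algebraMap K L)) (hvM : ExtendsAV vK vM (algebraMap K M))
    -- the decomposition of `L ⊗[K] M` as a finite product of fields `Fᵢ`
    {n : ℕ} (F : Fin n → Type*) [∀ i, Field (F i)]
    [∀ i, Algebra K (F i)] [∀ i, Algebra L (F i)] [∀ i, Algebra M (F i)]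
    [∀ i, IsScalarTower K L (F i)] [∀ i, IsScalarTower K M (F i)]
    (e : (L ⊗[K] M) ≃ₐ[K] ((i : Fin n) → F i))
    (he : ∀ (i : Fin n) (l : L) (m : M),
      e (l ⊗ₜ[K] m) i = algebraMap L (F i) l * algebraMap M (F i) m)
    -- the completions `K̂`, `L̂`, `M̂`
    {Kh Lh Mh : Type*} [Field Kh] [Field Lh] [Field Mh]
    [Algebra K Kh] [Algebra L Lh] [Algebra M Mh]
    [Algebra Kh Lh] [Algebra Kh Mh] [Algebra K Lh] [Algebra K Mh]
    [IsScalarTower K Kh Lh] [IsScalarTower K L Lh]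
    [IsScalarTower K Kh Mh] [IsScalarTower K M Mh]
    (vKh : AbsoluteValue Kh ℝ) (vLh : AbsoluteValue Lh ℝ) (vMh : AbsoluteValue Mh ℝ)
    (hKh : IsCompletion vK vKh (algebraMap K Kh))
    (hLh : IsCompletion vL vLh (algebraMap L Lh))
    (hMh : IsCompletion vM vMh (algebraMap M Mh))
    (hKhLh : ExtendsAV vKh vLh (algebraMap Kh Lh))
    (hKhMh : ExtendsAV vKh vMh (algebraMap Kh Mh))
    -- `V i` is the (finite) set `𝒱ᵢ` of absolute values on `Fᵢ` extending both `vL` and `vM`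
    (V : (i : Fin n) → Finset (AbsoluteValue (F i) ℝ))
    (hV : ∀ (i : Fin n) (w : AbsoluteValue (F i) ℝ), w ∈ V i ↔
      (ExtendsAV vL w (algebraMap L (F i)) ∧ ExtendsAV vM w (algebraMap M (F i))))
    -- for each `i` and `w ∈ 𝒱ᵢ`, a completion `F̂_{i,w}` of `Fᵢ` at `w`, extending `M̂`
    (Fh : (i : Fin n) → AbsoluteValue (F i) ℝ → Type*)
    [∀ i w, Field (Fh i w)] [∀ i w, Algebra (F i) (Fh i w)] [∀ i w, Algebra Mh (Fh i w)]
    [∀ i w, Algebra M (Fh i w)] [∀ i w, IsScalarTower M Mh (Fh i w)]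
    [∀ i w, IsScalarTower M (F i) (Fh i w)]
    (vFh : (i : Fin n) → (w : AbsoluteValue (F i) ℝ) → AbsoluteValue (Fh i w) ℝ)
    (hFh : ∀ i, ∀ w ∈ V i, IsCompletion w (vFh i w) (algebraMap (F i) (Fh i w)))
    (hFhM : ∀ i, ∀ w ∈ V i, ExtendsAV vMh (vFh i w) (algebraMap Mh (Fh i w))) :
    ∑ i : Fin n, ∑ w ∈ V i, Module.finrank Mh (Fh i w) = Module.finrank Kh Lh := by
  obtain ⟨hfin, -⟩ := span_range_algebraMap_eq_top_of_isCompletion K hKh.complete hLh hKhLh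
  have hsep : Algebra.IsSeparable Kh Lh := isSeparable_of_isCompletion K hKh.complete hLh hKhLh
  have : Algebra.FormallyUnramified Kh Lh := Algebra.FormallyUnramified.of_isSeparable Kh Lh
  have : IsReduced (Mh ⊗[Kh] Lh) := Algebra.FormallyUnramified.isReduced_of_field Mh _
  have : IsArtinianRing (Mh ⊗[Kh] Lh) := IsArtinianRing.of_finite Mh _
  let _ : Fintype (MaximalSpectrum (Mh ⊗[Kh] Lh)) := Fintype.ofFinite _
  obtain ⟨τ, hτ⟩ := exists_tensorProduct_ringHom K L M Kh Lh Mh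
  have hex : ∀ s : (Σ i, V i), ∃ φ : Mh ⊗[Kh] Lh →ₐ[Mh] Fh s.1 s.2, Function.Surjective φ ∧
      (∀ l m, φ (algebraMap M Mh m ⊗ₜ algebraMap L Lh l) =
        algebraMap (F s.1) (Fh s.1 s.2) (algebraMap L (F s.1) l * algebraMap M (F s.1) m)) ∧
      ∀ m l, vFh s.1 s.2 (φ (m ⊗ₜ l)) = vMh m * vLh l := fun ⟨i, w, hwV⟩ =>
    exists_surjective_algHom_of_isCompletion hKh hLh hMh.complete hKhLh hKhMh (fun t => e t i)
      (fun x => ⟨e.symm (Pi.single i x), by simp⟩) (by simp) (he i) ((hV i w).1 hwV).1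
      (hFh i w hwV) (hFhM i w hwV)
  choose φ hsurj hφLM hφv using hex
  have hφτ : ∀ s t, φ s (τ t) = algebraMap (F s.1) (Fh s.1 s.2) (e t s.1) := fun s t => by
    induction t with
    | zero => simp
    | add x y hx hy => rw [map_add, map_add, hx, hy, map_add, Pi.add_apply, map_add]
    | tmul l m => rw [hτ, hφLM, he]
  let Φ : (Σ i, V i) → MaximalSpectrum (Mh ⊗[Kh] Lh) := fun s =>
    ⟨RingHom.ker (φ s), RingHom.ker_isMaximal_of_surjective _ (hsurj s)⟩
  have hinj : Function.Injective Φ := by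
    intro s s' hss
    have hker : RingHom.ker (φ s) = RingHom.ker (φ s') := congrArg MaximalSpectrum.asIdeal hss
    have : FiniteDimensional Mh (Fh s.1 s.2) :=
      Module.Finite.of_surjective (φ s).toLinearMap (hsurj s)
    have hle : ∀ a ∈ RingHom.ker (φ s), φ s' a = 0 := fun a ha => by rwa [hker] at ha
    let g : Fh s.1 s.2 →ₐ[Mh] Fh s'.1 s'.2 :=
      (Ideal.Quotient.liftₐ (RingHom.ker (φ s)) (φ s') hle).comp
      (Ideal.quotientKerAlgEquivOfSurjective (hsurj s)).symm.toAlgHom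
    have hg : ∀ a, g (φ s a) = φ s' a := fun a => by
      have : (Ideal.quotientKerAlgEquivOfSurjective (hsurj s)).symm (φ s a) =
          Ideal.Quotient.mk _ a := by
        rw [AlgEquiv.symm_apply_eq]; rfl
      change Ideal.Quotient.liftₐ (RingHom.ker (φ s)) (φ s') hle
        ((Ideal.quotientKerAlgEquivOfSurjective (hsurj s)).symm (φ s a)) = _
      rw [this]; rfl
    have huniq : vFh s.1 s.2 = (vFh s'.1 s'.2).comapRH g.toRingHom :=
      ExtendsAV.unique hMh.complete (hFhM _ _ s.2.2) fun x =>
        (congrArg _ (g.commutes x)).trans (hFhM _ _ s'.2.2 x)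
    have hval : ∀ a, vFh s.1 s.2 (φ s a) = vFh s'.1 s'.2 (φ s' a) := fun a => by
      rw [huniq, ← hg a]; rfl
    have hval' : ∀ x : (∀ i, F i), s.2.1 (x s.1) = s'.2.1 (x s'.1) := fun x => by
      have := hval (τ (e.symm x))
      rwa [hφτ, hφτ, e.apply_symm_apply, (hFh _ _ s.2.2).extendsAV,
        (hFh _ _ s'.2.2).extendsAV] at this
    obtain ⟨i, w, hw⟩ := s
    obtain ⟨i', w', hw'⟩ := s'
    obtain rfl : i = i' := by
      by_contra hne
      have := hval' (Pi.single i 1)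
      simp [Pi.single_eq_of_ne (Ne.symm hne)] at this
    obtain rfl : w = w' := AbsoluteValue.ext fun x => by
      simpa using hval' (Pi.single i x)
    rfl
  have hsurjΦ : Function.Surjective Φ := by
    intro m
    let _ : Field ((Mh ⊗[Kh] Lh) ⧸ m.asIdeal) := Ideal.Quotient.field m.asIdeal
    obtain ⟨u, hu⟩ := exists_extendsAV (E := (Mh ⊗[Kh] Lh) ⧸ m.asIdeal) vMh
    let ψ : Mh ⊗[Kh] Lh →+* (Mh ⊗[Kh] Lh) ⧸ m.asIdeal := Ideal.Quotient.mk m.asIdeal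
    have hψM : ∀ x, u (ψ (x ⊗ₜ 1)) = vMh x := hu
    have hψL : ∀ y, u (ψ (1 ⊗ₜ y)) = vLh y := fun y => by
      have : u.comapRH (ψ.comp (Algebra.TensorProduct.includeRight :
          Lh →ₐ[Kh] Mh ⊗[Kh] Lh).toRingHom) = vLh :=
        ExtendsAV.unique hKh.complete (fun x => by
          change u (ψ (1 ⊗ₜ algebraMap Kh Lh x)) = _
          rw [Algebra.algebraMap_eq_smul_one, ← TensorProduct.smul_tmul,
            ← Algebra.algebraMap_eq_smul_one, hψM, hKhMh]) hKhLh
      rw [← this]; rfl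
    have hψv : ∀ x y, u (ψ (x ⊗ₜ y)) = vMh x * vLh y := fun x y => by
      rw [← hψM, ← hψL, ← map_mul, ← map_mul, Algebra.TensorProduct.tmul_mul_tmul, one_mul,
        mul_one]
    obtain ⟨i, g, hg⟩ := exists_factor_pi ((ψ.comp τ).comp e.symm.toRingEquiv.toRingHom)
    replace hg : ∀ t, ψ (τ t) = g (e t i) := fun t => by
      rw [← hg]; exact congrArg (fun t => ψ (τ t)) (e.symm_apply_apply t).symm
    have hwV : u.comapRH g ∈ V i := by
      refine (hV i _).2 ⟨fun l => ?_, fun x => ?_⟩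
      · have := hg (l ⊗ₜ 1)
        rw [he, hτ, map_one, map_one, mul_one] at this
        change u (g _) = _
        rw [← this, hψL, hLh.extendsAV]
      · have := hg (1 ⊗ₜ x)
        rw [he, hτ, map_one, map_one, one_mul] at this
        change u (g _) = _
        rw [← this, hψM, hMh.extendsAV]
    refine ⟨⟨i, _, hwV⟩, MaximalSpectrum.ext (Ideal.ext fun a => ?_)⟩
    have hval := absoluteValue_eq_of_tensorProduct hLh hMh hτ (u₂ := u) (φ₂ := ψ)
      (φ₁ := (φ ⟨i, _, hwV⟩).toRingHom) (hφv ⟨i, _, hwV⟩) hψv (fun t => by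
        refine (congrArg _ (hφτ ⟨i, _, hwV⟩ t)).trans ?_
        rw [hg, (hFh i _ hwV).extendsAV]; rfl) a
    change φ ⟨i, _, hwV⟩ a = 0 ↔ _
    rw [← Ideal.Quotient.eq_zero_iff_mem, ← (vFh i _).eq_zero, ← u.eq_zero]
    exact (congrArg (· = 0) hval).to_iff
  have hdeg : ∀ s, Module.finrank Mh (Fh s.1 s.2) =
      Module.finrank Mh ((Mh ⊗[Kh] Lh) ⧸ (Φ s).asIdeal) := fun s =>
    (Ideal.quotientKerAlgEquivOfSurjective (hsurj s)).toLinearEquiv.finrank_eq.symm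
  calc ∑ i : Fin n, ∑ w ∈ V i, Module.finrank Mh (Fh i w)
      = ∑ i : Fin n, ∑ w : V i, Module.finrank Mh (Fh i w) :=
        Finset.sum_congr rfl fun i _ =>
          (Finset.sum_coe_sort (V i) fun w => Module.finrank Mh (Fh i w)).symm
    _ = ∑ s : (Σ i, V i), Module.finrank Mh (Fh s.1 s.2) := by
        rw [← Finset.univ_sigma_univ, Finset.sum_sigma]
    _ = ∑ m : MaximalSpectrum (Mh ⊗[Kh] Lh), Module.finrank Mh ((Mh ⊗[Kh] Lh) ⧸ m.asIdeal) :=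
        Fintype.sum_bijective Φ ⟨hinj, hsurjΦ⟩ _ _ hdeg
    _ = Module.finrank Mh (Mh ⊗[Kh] Lh) := finrank_eq_sum_maximalSpectrum.symm
    _ = Module.finrank Kh Lh := Module.finrank_baseChange
end
end

section
/- There is a canonical bijection between the set of all absolute values on F which extend both |·|_L and |·|_M, and the set of equivalence classes of ℰ, where two embeddings in ℰ are equivalent if and only if they differ by composition with an M̂-algebra automorphism of M̂^a. -/
noncomputable section

namespace AbsoluteValue

variable {k E : Type*} [Field k] [Field E]

lemma absComplete_iff_completeSpace (v : AbsoluteValue k ℝ) :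
    AbsComplete v ↔ letI := v.toNormedField; CompleteSpace k := by
  let := v.toNormedField
  have hd (x y : k) : dist x y = v (x - y) := dist_eq_norm x y
  constructor
  · intro h
    refine Metric.complete_of_cauchySeq_tendsto fun s hs => ?_
    obtain ⟨a, ha⟩ := h s (by simpa [AbsCauchy, Metric.cauchySeq_iff, hd] using hs)
    exact ⟨a, by simpa [AbsTendsto, Metric.tendsto_atTop, hd] using ha⟩
  · intro h s hs
    obtain ⟨a, ha⟩ := cauchySeq_tendsto_of_complete (u := s)
      (by simpa [AbsCauchy, Metric.cauchySeq_iff, hd] using hs)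
    exact ⟨a, by simpa [AbsTendsto, Metric.tendsto_atTop, hd] using ha⟩

lemma le_of_pow_le_const_mul_pow {a b C : ℝ} (hb : 0 ≤ b)
    (h : ∀ n : ℕ, a ^ n ≤ C * b ^ n) : a ≤ b := by
  by_contra! hab
  rcases hb.eq_or_lt with rfl | hb
  · have := h 1
    simp at this
    linarith
  · obtain ⟨n, hn⟩ := pow_unbounded_of_one_lt C ((one_lt_div hb).2 hab)
    rw [div_pow, lt_div_iff₀ (pow_pos hb n)] at hn
    exact hn.not_ge (h n)

/-- The normed algebra structure attached to an extension of absolute values. -/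
abbrev normedAlgebraOfExtends [Algebra k E] {v : AbsoluteValue k ℝ} {w : AbsoluteValue E ℝ}
    (h : ExtendsAV v w (algebraMap k E)) :
    letI := v.toNormedField
    letI := w.toNormedField
    NormedAlgebra k E :=
  let := v.toNormedField
  let := w.toNormedField
  { ‹Algebra k E› with
    norm_smul_le := fun r x => by
      change w (r • x) ≤ v r * w x
      rw [Algebra.smul_def, map_mul, h] }

/-- A nontrivial absolute value makes a field a nontrivially normed field. -/
abbrev toNontriviallyNormedField (v : AbsoluteValue k ℝ) (hv : v.IsNontrivial) :
    NontriviallyNormedField k :=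
  let := v.toNormedField
  .ofNormNeOne (by obtain ⟨x, hx⟩ := hv; exact ⟨x, hx⟩)

lemma exists_repr_le [Algebra k E] [FiniteDimensional k E] {v : AbsoluteValue k ℝ}
    (hv : v.IsNontrivial) (hc : AbsComplete v) {w : AbsoluteValue E ℝ}
    (h : ExtendsAV v w (algebraMap k E)) {ι : Type*} [Fintype ι] (b : Module.Basis ι k E) (i : ι) :
    ∃ C : ℝ, ∀ y, v (b.repr y i) ≤ C * w y := by
  let := v.toNontriviallyNormedField hv
  let := w.toNormedField
  let := normedAlgebraOfExtends h
  have : CompleteSpace k := (absComplete_iff_completeSpace v).1 hc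
  let f : E →L[k] k := LinearMap.toContinuousLinearMap (b.coord i)
  exact ⟨‖f‖, fun y => f.le_opNorm y⟩

lemma le_sum_repr [Algebra k E] {v : AbsoluteValue k ℝ} {w : AbsoluteValue E ℝ}
    (h : ExtendsAV v w (algebraMap k E)) {ι : Type*} [Fintype ι] (b : Module.Basis ι k E) (y : E) :
    w y ≤ ∑ i, v (b.repr y i) * w (b i) := by
  conv_lhs => rw [← b.sum_repr y]
  refine (w.sum_le _ _).trans_eq (Finset.sum_congr rfl fun i _ => ?_)
  rw [Algebra.smul_def, map_mul, h]

lemma le_of_extends_of_finiteDimensional [Algebra k E] [FiniteDimensional k E]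
    {v : AbsoluteValue k ℝ} (hv : v.IsNontrivial) (hc : AbsComplete v)
    {w₁ w₂ : AbsoluteValue E ℝ} (h₁ : ExtendsAV v w₁ (algebraMap k E))
    (h₂ : ExtendsAV v w₂ (algebraMap k E)) (x : E) : w₁ x ≤ w₂ x := by
  let b := Module.finBasis k E
  choose C hC using fun i => exists_repr_le hv hc h₂ b i
  refine le_of_pow_le_const_mul_pow (C := ∑ i, C i * w₁ (b i)) (w₂.nonneg x)
    fun n => ?_
  rw [← map_pow, ← map_pow, Finset.sum_mul]
  refine (le_sum_repr h₁ b _).trans (Finset.sum_le_sum fun i _ => ?_)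
  rw [mul_right_comm]
  exact mul_le_mul_of_nonneg_right (hC i _) (w₁.nonneg _)

lemma le_one_of_extends_of_not_isNontrivial [Algebra k E] [FiniteDimensional k E]
    {v : AbsoluteValue k ℝ} (hv : ¬ v.IsNontrivial) {w : AbsoluteValue E ℝ}
    (h : ExtendsAV v w (algebraMap k E)) (x : E) : w x ≤ 1 := by
  let b := Module.finBasis k E
  refine le_of_pow_le_const_mul_pow (C := ∑ i, w (b i)) zero_le_one fun n => ?_
  rw [← map_pow, one_pow, mul_one]
  refine (le_sum_repr h b _).trans (Finset.sum_le_sum fun i _ => ?_)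
  refine mul_le_of_le_one_left (w.nonneg _) ?_
  by_cases hx : b.repr (x ^ n) i = 0
  · simp [hx]
  · exact (not_isNontrivial_apply hv hx).le

lemma extendsAV_intermediateField [Algebra k E] {v : AbsoluteValue k ℝ} {w : AbsoluteValue E ℝ}
    (h : ExtendsAV v w (algebraMap k E)) (S : IntermediateField k E) :
    ExtendsAV v (w.comapRH (algebraMap S E)) (algebraMap k S) := fun x => h x

lemma not_isNontrivial_of_extends [Algebra k E] [Algebra.IsAlgebraic k E]
    {v : AbsoluteValue k ℝ} (hv : ¬ v.IsNontrivial) {w : AbsoluteValue E ℝ}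
    (h : ExtendsAV v w (algebraMap k E)) : ¬ w.IsNontrivial := by
  have hle (x : E) : w x ≤ 1 := by
    have := IntermediateField.adjoin.finiteDimensional (Algebra.IsIntegral.isIntegral (R := k) x)
    exact le_one_of_extends_of_not_isNontrivial hv
      (extendsAV_intermediateField h (IntermediateField.adjoin k {x}))
      (IntermediateField.AdjoinSimple.gen k x)
  rintro ⟨x, hx0, hx1⟩
  refine hx1 (le_antisymm (hle x) ?_)
  have := hle x⁻¹
  rw [map_inv₀] at this
  exact (inv_le_one₀ (w.pos hx0)).1 this

/-- An absolute value on a complete field extends in at most one way to an algebraic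
extension. -/
theorem eq_of_extends_of_absComplete [Algebra k E] [Algebra.IsAlgebraic k E]
    {v : AbsoluteValue k ℝ} (hc : AbsComplete v)
    {w₁ w₂ : AbsoluteValue E ℝ} (h₁ : ExtendsAV v w₁ (algebraMap k E))
    (h₂ : ExtendsAV v w₂ (algebraMap k E)) : w₁ = w₂ := by
  ext x
  by_cases hv : v.IsNontrivial
  · have := IntermediateField.adjoin.finiteDimensional (Algebra.IsIntegral.isIntegral (R := k) x)
    have h₁' := extendsAV_intermediateField h₁ (IntermediateField.adjoin k {x})
    have h₂' := extendsAV_intermediateField h₂ (IntermediateField.adjoin k {x})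
    exact le_antisymm
      (le_of_extends_of_finiteDimensional hv hc h₁' h₂' (IntermediateField.AdjoinSimple.gen k x))
      (le_of_extends_of_finiteDimensional hv hc h₂' h₁' (IntermediateField.AdjoinSimple.gen k x))
  · rcases eq_or_ne x 0 with rfl | hx
    · simp
    · rw [not_isNontrivial_apply (not_isNontrivial_of_extends hv h₁) hx,
        not_isNontrivial_apply (not_isNontrivial_of_extends hv h₂) hx]

end AbsoluteValue

namespace IsCompletion

open AbsoluteValue

variable {A B C : Type*} [Field A] [Field B] [Field C] {vA : AbsoluteValue A ℝ}
  {vB : AbsoluteValue B ℝ} {f : A →+* B}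

lemma denseRange (hf : IsCompletion vA vB f) : letI := vB.toNormedField; DenseRange f := by
  let := vB.toNormedField
  refine Metric.denseRange_iff.2 fun y ε hε => ?_
  obtain ⟨x, hx⟩ := hf.dense y ε hε
  exact ⟨x, (dist_eq_norm y (f x)).trans_lt hx⟩

lemma exists_extension (hf : IsCompletion vA vB f) {vC : AbsoluteValue C ℝ} (hC : AbsComplete vC)
    {g : A →+* C} (hg : ExtendsAV vA vC g) :
    ∃ h : B →+* C, ExtendsAV vB vC h ∧ ∀ x, h (f x) = g x := by
  have hd := hf.denseRange
  let := vA.toNormedField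
  let := vB.toNormedField
  let := vC.toNormedField
  have : CompleteSpace C := (absComplete_iff_completeSpace vC).1 hC
  have hfi : Isometry f := AddMonoidHomClass.isometry_of_norm f hf.extendsAV
  have hgi : Isometry g := AddMonoidHomClass.isometry_of_norm g hg
  let h : B →+* C := IsDenseInducing.extendRingHom hfi.isUniformInducing hd hgi.uniformContinuous
  have hh : Continuous h :=
    (uniformContinuous_uniformly_extend hfi.isUniformInducing hd hgi.uniformContinuous).continuous
  have hfg (x : A) : h (f x) = g x :=
    IsDenseInducing.extend_eq (hfi.isUniformInducing.isDenseInducing hd) hgi.continuous x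
  refine ⟨h, fun y => ?_, hfg⟩
  refine congrFun (hd.equalizer (g := fun y => ‖h y‖) (h := fun y => ‖y‖)
    hh.norm continuous_norm (funext fun x => ?_)) y
  change vC (h (f x)) = vB (f x)
  rw [hfg, hg, hf.extendsAV]

lemma ringHom_ext (hf : IsCompletion vA vB f) {vC : AbsoluteValue C ℝ} {h₁ h₂ : B →+* C}
    (e₁ : ExtendsAV vB vC h₁) (e₂ : ExtendsAV vB vC h₂) (h : ∀ x, h₁ (f x) = h₂ (f x)) :
    h₁ = h₂ := by
  have hd := hf.denseRange
  let := vB.toNormedField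
  let := vC.toNormedField
  have i₁ : Isometry h₁ := AddMonoidHomClass.isometry_of_norm h₁ e₁
  have i₂ : Isometry h₂ := AddMonoidHomClass.isometry_of_norm h₂ e₂
  exact DFunLike.coe_injective (hd.equalizer i₁.continuous i₂.continuous (funext h))

lemma surjective_of_not_isNontrivial (hf : IsCompletion vA vB f) (hv : ¬ vA.IsNontrivial) :
    Function.Surjective f := by
  intro y
  obtain ⟨x, hx⟩ := hf.dense y (1 / 2) (by norm_num)
  refine ⟨x, ?_⟩
  by_contra hne
  have hpos : 0 < vB (y - f x) := vB.pos (sub_ne_zero.2 (Ne.symm hne))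
  obtain ⟨x', hx'⟩ := hf.dense y _ hpos
  have hlt : vA (x - x') < 1 := by
    rw [← hf.extendsAV, map_sub]
    calc vB (f x - f x') ≤ vB (f x - y) + vB (y - f x') := vB.sub_le _ _ _
      _ < 1 := by rw [vB.map_sub (f x)]; linarith
  have hxx : x = x' := by
    by_contra hne'
    exact hlt.ne (not_isNontrivial_apply hv (sub_ne_zero.2 hne'))
  exact absurd (hxx ▸ hx') (lt_irrefl _)

/-- If `L/K` is finite and the absolute value of `L` extends the one of `K`, then the
completion of `L` is algebraic over the completion of `K`. -/
theorem isAlgebraic {K L Kh Lh : Type*} [Field K] [Field L] [Field Kh] [Field Lh]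
    [Algebra K L] [FiniteDimensional K L] [Algebra K Kh] [Algebra L Lh] [Algebra Kh Lh]
    [Algebra K Lh] [IsScalarTower K Kh Lh] [IsScalarTower K L Lh]
    {vK : AbsoluteValue K ℝ} {vL : AbsoluteValue L ℝ} (hvL : ExtendsAV vK vL (algebraMap K L))
    {vKh : AbsoluteValue Kh ℝ} {vLh : AbsoluteValue Lh ℝ}
    (hKh : IsCompletion vK vKh (algebraMap K Kh))
    (hLh : IsCompletion vL vLh (algebraMap L Lh))
    (hKhLh : ExtendsAV vKh vLh (algebraMap Kh Lh)) : Algebra.IsAlgebraic Kh Lh := by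
  have halg (x : L) : IsAlgebraic Kh (algebraMap L Lh x) :=
    ((Algebra.IsAlgebraic.isAlgebraic (R := K) x).algebraMap).tower_top Kh
  by_cases hv : vKh.IsNontrivial
  · have hd := hLh.denseRange
    let := vKh.toNontriviallyNormedField hv
    let := vLh.toNormedField
    let := normedAlgebraOfExtends hKhLh
    have : CompleteSpace Kh := (absComplete_iff_completeSpace vKh).1 hKh.complete
    let b := Module.finBasis K L
    let S := Submodule.span Kh (Set.range fun i => algebraMap L Lh (b i))
    have : FiniteDimensional Kh S := FiniteDimensional.span_of_finite Kh (Set.finite_range _)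
    have hmem (x : L) : algebraMap L Lh x ∈ S := by
      rw [← b.sum_repr x, map_sum]
      refine Submodule.sum_mem _ fun i _ => ?_
      rw [Algebra.smul_def, map_mul, ← IsScalarTower.algebraMap_apply K L Lh,
        IsScalarTower.algebraMap_apply K Kh Lh, ← Algebra.smul_def]
      exact Submodule.smul_mem _ _ (Submodule.subset_span ⟨i, rfl⟩)
    have hS : S = ⊤ := SetLike.coe_injective <| by
      rw [← (Submodule.closed_of_finiteDimensional S).closure_eq, Submodule.top_coe]
      exact (hd.mono (Set.range_subset_iff.2 hmem)).closure_eq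
    have : FiniteDimensional Kh Lh :=
      Module.finite_def.2 (hS ▸ Submodule.fg_span (Set.finite_range _))
    exact Algebra.IsAlgebraic.of_finite Kh Lh
  · have hvK : ¬ vK.IsNontrivial := by
      rintro ⟨x, hx0, hx1⟩
      refine hv ⟨algebraMap K Kh x, by simpa using hx0, ?_⟩
      rwa [hKh.extendsAV]
    refine ⟨fun y => ?_⟩
    obtain ⟨x, rfl⟩ :=
      hLh.surjective_of_not_isNontrivial (not_isNontrivial_of_extends hvK hvL) y
    exact halg x

end IsCompletion

lemma absComplete_toAbsoluteValue (B : Type*) [NormedField B] [CompleteSpace B] :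
    AbsComplete (NormedField.toAbsoluteValue B) := by
  intro s hs
  have hd (x y : B) : dist x y = NormedField.toAbsoluteValue B (x - y) := dist_eq_norm x y
  obtain ⟨a, ha⟩ := cauchySeq_tendsto_of_complete (u := s)
    (by simpa [AbsCauchy, Metric.cauchySeq_iff, hd] using hs)
  exact ⟨a, by simpa [AbsTendsto, Metric.tendsto_atTop, hd] using ha⟩

lemma exists_isCompletion.{u} {A : Type u} [Field A] (v : AbsoluteValue A ℝ) :
    ∃ (B : Type u) (_ : Field B) (g : A →+* B) (w : AbsoluteValue B ℝ), IsCompletion v w g := by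
  refine ⟨v.Completion, inferInstance,
    UniformSpace.Completion.coeRingHom.comp (WithAbs.equiv v).symm.toRingHom,
    NormedField.toAbsoluteValue _, fun x => UniformSpace.Completion.norm_coe _,
    absComplete_toAbsoluteValue _, fun y ε hε => ?_⟩
  obtain ⟨x, hx⟩ := Metric.denseRange_iff.1
    (UniformSpace.Completion.denseRange_coe (α := WithAbs v)) y ε hε
  exact ⟨WithAbs.equiv v x, (dist_eq_norm y _).symm.trans_lt hx⟩

namespace AbsoluteValue

variable {k E : Type*} [Field k] [Field E]

lemma le_of_pow_le_succ_mul_pow {a b : ℝ} (hb : 0 ≤ b)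
    (h : ∀ n : ℕ, a ^ n ≤ (n + 1) * b ^ n) : a ≤ b := by
  by_contra! hab
  rcases hb.eq_or_lt with rfl | hb
  · have := h 1
    simp at this
    linarith
  · have hr := (one_lt_div hb).2 hab
    obtain ⟨n, hn, hn1⟩ := (((tendsto_pow_const_div_const_pow_of_one_lt 1 hr).eventually
      (gt_mem_nhds (show (0 : ℝ) < 1 / 2 by norm_num))).and (Filter.eventually_ge_atTop 1)).exists
    have hpos : 0 < b ^ n := pow_pos hb n
    have h2 : (a / b) ^ n ≤ n + 1 := by
      rw [div_pow, div_le_iff₀ hpos]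
      exact h n
    rw [pow_one, div_lt_iff₀ (by positivity)] at hn
    have : (1 : ℝ) ≤ n := by exact_mod_cast hn1
    linarith

/-- A power of an absolute value which satisfies the triangle inequality. -/
def rpow (v : AbsoluteValue k ℝ) {c : ℝ} (hc : 0 < c)
    (h : ∀ x y, v (x + y) ^ c ≤ v x ^ c + v y ^ c) : AbsoluteValue k ℝ where
  toFun x := v x ^ c
  map_mul' x y := by rw [map_mul, Real.mul_rpow (v.nonneg _) (v.nonneg _)]
  nonneg' x := Real.rpow_nonneg (v.nonneg _) _
  eq_zero' x := by rw [Real.rpow_eq_zero (v.nonneg _) hc.ne', v.eq_zero]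
  add_le' := h

lemma absComplete_rpow {v : AbsoluteValue k ℝ} (hv : AbsComplete v) {c : ℝ} (hc : 0 < c)
    (h : ∀ x y, v (x + y) ^ c ≤ v x ^ c + v y ^ c) : AbsComplete (v.rpow hc h) := by
  intro s hs
  obtain ⟨a, ha⟩ := hv s fun ε hε => by
    obtain ⟨N, hN⟩ := hs (ε ^ c) (Real.rpow_pos_of_pos hε c)
    exact ⟨N, fun m hm n hn => (Real.rpow_lt_rpow_iff (v.nonneg _) hε.le hc).1 (hN m hm n hn)⟩
  refine ⟨a, fun ε hε => ?_⟩
  obtain ⟨N, hN⟩ := ha (ε ^ c⁻¹) (Real.rpow_pos_of_pos hε _)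
  exact ⟨N, fun n hn => (Real.lt_rpow_inv_iff_of_pos (v.nonneg _) hε.le hc).1 (hN n hn)⟩

lemma rpow_add_le_of_natCast {v : AbsoluteValue k ℝ} {c : ℝ} (hc : 0 < c)
    (hn : ∀ n : ℕ, v n ^ c = n) (x y : k) : v (x + y) ^ c ≤ v x ^ c + v y ^ c := by
  have hx : 0 ≤ v x ^ c := Real.rpow_nonneg (v.nonneg _) _
  have hy : 0 ≤ v y ^ c := Real.rpow_nonneg (v.nonneg _) _
  rw [← Real.le_rpow_inv_iff_of_pos (v.nonneg _) (add_nonneg hx hy) hc]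
  have hD : 0 ≤ (v x ^ c + v y ^ c) ^ c⁻¹ := Real.rpow_nonneg (add_nonneg hx hy) _
  refine le_of_pow_le_succ_mul_pow hD fun n => ?_
  rw [← map_pow, add_pow]
  refine (v.sum_le _ _).trans ?_
  refine (Finset.sum_le_card_nsmul _ _ (((v x ^ c + v y ^ c) ^ c⁻¹) ^ n) fun m hm => ?_).trans_eq
    (by simp)
  rw [← Real.rpow_le_rpow_iff (v.nonneg _) (pow_nonneg hD n) hc, ← Real.rpow_pow_comm hD,
    Real.rpow_inv_rpow (add_nonneg hx hy) hc.ne', add_pow]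
  have hterm : v (x ^ m * y ^ (n - m) * (n.choose m : ℕ)) ^ c
      = (v x ^ c) ^ m * (v y ^ c) ^ (n - m) * (n.choose m : ℕ) := by
    rw [map_mul, map_mul, map_pow, map_pow, Real.mul_rpow (by positivity) (by positivity),
      Real.mul_rpow (by positivity) (by positivity), hn, Real.rpow_pow_comm (v.nonneg _),
      Real.rpow_pow_comm (v.nonneg _)]
  rw [hterm]
  exact Finset.single_le_sum (f := fun m => (v x ^ c) ^ m * (v y ^ c) ^ (n - m) * (n.choose m : ℕ))
    (fun i _ => by positivity) hm

lemma charZero_of_exists_one_lt_natCast {v : AbsoluteValue k ℝ} (h : ∃ n : ℕ, 1 < v n) :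
    CharZero k := by
  obtain ⟨n, hn⟩ := h
  obtain ⟨p, hp⟩ := CharP.exists k
  rcases CharP.char_is_prime_or_zero k p with hp' | rfl
  · have : Fact p.Prime := ⟨hp'⟩
    have h1 : v n ^ p = v n := by rw [← map_pow, ← frobenius_def, map_natCast]
    exact absurd h1 (lt_self_pow₀ hn hp'.one_lt).ne'
  · exact CharP.charP_to_charZero k

lemma exists_rpow_natCast_eq {v : AbsoluteValue k ℝ} (h : ∃ n : ℕ, 1 < v n) :
    ∃ c : ℝ, 1 ≤ c ∧ ∀ n : ℕ, v n ^ c = n := by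
  have := charZero_of_exists_one_lt_natCast h
  obtain ⟨c, hc, hcn⟩ := Rat.AbsoluteValue.exists_nat_rpow_iff_isEquiv.2
    (Rat.AbsoluteValue.equiv_real_of_unbounded (f := v.comapRH (Rat.castHom k)) (by
      obtain ⟨n, hn⟩ := h
      exact fun hb => hn.not_ge (by simpa [comapRH] using hb n)))
  have hcn' (n : ℕ) : v n ^ c = n := by simpa [comapRH] using hcn n
  refine ⟨c, ?_, hcn'⟩
  have h2 : v (2 : ℕ) ≤ (2 : ℕ) := v.apply_nat_le_self 2
  have h3 := Real.rpow_le_rpow (v.nonneg _) h2 hc.le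
  rw [hcn'] at h3
  have := (Real.rpow_le_rpow_left_iff (x := 2) (y := 1) (z := c) one_lt_two).1
    (by simpa using h3)
  exact this

lemma isCompletion_rat_real :
    IsCompletion Rat.AbsoluteValue.real (NormedField.toAbsoluteValue ℝ) (Rat.castHom ℝ) where
  extendsAV _ := Real.norm_eq_abs _
  complete := absComplete_toAbsoluteValue ℝ
  dense y ε hε := Metric.denseRange_iff.1 Rat.isDenseEmbedding_coe_real.dense y ε hε

/-- Ostrowski: a complete field in which natural numbers have their usual absolute value. -/
lemma exists_extends_of_natCast [Algebra k E] [IsAlgClosure k E] {u : AbsoluteValue k ℝ}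
    (hc : AbsComplete u) (hn : ∀ n : ℕ, u n = n) :
    ∃ w : AbsoluteValue E ℝ, ExtendsAV u w (algebraMap k E) := by
  have := charZero_of_exists_one_lt_natCast (v := u) ⟨2, by rw [hn]; norm_num⟩
  have hq : ExtendsAV Rat.AbsoluteValue.real u (Rat.castHom k) := by
    have : u.comapRH (Rat.castHom k) = Rat.AbsoluteValue.real :=
      Rat.AbsoluteValue.eq_on_nat_iff_eq.1 fun n => by simp [comapRH, hn]
    exact fun x => DFunLike.congr_fun this x
  obtain ⟨h, hh, -⟩ := isCompletion_rat_real.exists_extension hc hq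
  let := h.toAlgebra
  let := ((algebraMap k E).comp h).toAlgebra
  have : IsScalarTower ℝ k E := .of_algebraMap_eq fun _ => rfl
  have : Algebra.IsAlgebraic ℝ k := by
    have hh' : ExtendsAV (NormedField.toAbsoluteValue ℝ) u (algebraMap ℝ k) := hh
    let := u.toNormedField
    let : NormedAlgebra ℝ k :=
      { ‹Algebra ℝ k› with
        norm_smul_le := fun r x => by
          change u (r • x) ≤ ‖r‖ * u x
          rw [Algebra.smul_def, map_mul, hh']
          rfl }
    rcases NormedAlgebra.Real.nonempty_algEquiv_or k with ⟨⟨e⟩⟩ | ⟨⟨e⟩⟩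
    · exact e.symm.isAlgebraic
    · exact e.symm.isAlgebraic
  have : IsAlgClosure ℝ E := IsAlgClosure.ofAlgebraic ℝ k E
  have : IsAlgClosure ℝ ℂ := ⟨inferInstance, inferInstance⟩
  let e : E ≃ₐ[ℝ] ℂ := IsAlgClosure.equiv ℝ E ℂ
  let w := (NormedField.toAbsoluteValue ℂ).comapRH (e : E →+* ℂ)
  have hw : ExtendsAV (NormedField.toAbsoluteValue ℝ) (w.comapRH (algebraMap k E))
      (algebraMap ℝ k) := by
    intro r
    change ‖e (algebraMap k E (algebraMap ℝ k r))‖ = ‖r‖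
    rw [← IsScalarTower.algebraMap_apply, e.commutes, norm_algebraMap']
  refine ⟨w, fun x => ?_⟩
  exact DFunLike.congr_fun (eq_of_extends_of_absComplete (absComplete_toAbsoluteValue ℝ) hw hh) x

/-- An absolute value on a complete field extends to the algebraic closure. -/
theorem exists_extends [Algebra k E] [IsAlgClosure k E] {v : AbsoluteValue k ℝ}
    (hc : AbsComplete v) : ∃ w : AbsoluteValue E ℝ, ExtendsAV v w (algebraMap k E) := by
  have : Algebra.IsAlgebraic k E := IsAlgClosure.isAlgebraic
  by_cases hv : v.IsNontrivial
  · by_cases hn : ∀ n : ℕ, v n ≤ 1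
    · let := v.toNontriviallyNormedField hv
      have : CompleteSpace k := (absComplete_iff_completeSpace v).1 hc
      have : IsUltrametricDist k :=
        IsUltrametricDist.isUltrametricDist_of_forall_norm_natCast_le_one hn
      let := spectralNorm.normedField k E
      exact ⟨NormedField.toAbsoluteValue E, fun x => spectralNorm_extends x⟩
    · push Not at hn
      obtain ⟨c, hc1, hcn⟩ := exists_rpow_natCast_eq hn
      have hc0 : 0 < c := zero_lt_one.trans_le hc1
      obtain ⟨w, hw⟩ := exists_extends_of_natCast (E := E)
        (absComplete_rpow hc hc0 (rpow_add_le_of_natCast hc0 hcn)) hcn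
      refine ⟨w.rpow (inv_pos.2 hc0) fun x y => ?_, fun x => ?_⟩
      · exact (Real.rpow_le_rpow (w.nonneg _) (w.add_le x y) (inv_pos.2 hc0).le).trans
          (Real.rpow_add_le_add_rpow (w.nonneg _) (w.nonneg _) (inv_pos.2 hc0).le
            (inv_le_one_of_one_le₀ hc1))
      · change w _ ^ c⁻¹ = _
        rw [hw]
        exact Real.rpow_rpow_inv (v.nonneg _) hc0.ne'
  · classical
    refine ⟨AbsoluteValue.trivial, fun x => ?_⟩
    by_cases hx : x = 0
    · simp [hx]
    · rw [not_isNontrivial_apply hv hx]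
      simp [hx]

end AbsoluteValue

/-- Two homomorphisms into an algebraic closure, the kernel of the first being contained in the
kernel of the second, are conjugate. -/
lemma IsAlgClosure.exists_algEquiv_of_ker_le {k A E : Type*} [Field k] [CommRing A] [Algebra k A]
    [Field E] [Algebra k E] [IsAlgClosure k E] (φ ψ : A →ₐ[k] E)
    (h : RingHom.ker φ ≤ RingHom.ker ψ) : ∃ τ : E ≃ₐ[k] E, ∀ a, ψ a = τ (φ a) := by
  have : Algebra.IsAlgebraic k E := IsAlgClosure.isAlgebraic
  have : IsAlgClosed E := IsAlgClosure.isAlgClosed k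
  let I := RingHom.ker φ
  let f : A ⧸ I →ₐ[k] E := Ideal.kerLiftAlg φ
  let g : A ⧸ I →ₐ[k] E := Ideal.Quotient.liftₐ I ψ h
  have hf : Function.Injective f := Ideal.kerLiftAlg_injective φ
  have : I.IsPrime := RingHom.ker_isPrime φ
  have : Algebra.IsIntegral k (A ⧸ I) := Algebra.IsIntegral.of_injective f hf
  have : I.IsMaximal := Ideal.Quotient.maximal_of_isField I
    (isField_of_isIntegral_of_isField' (Field.toIsField k))
  let := Ideal.Quotient.field I
  let := f.toRingHom.toAlgebra
  have : IsScalarTower k (A ⧸ I) E := .of_algebraMap_eq fun x => (f.commutes x).symm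
  have : Algebra.IsAlgebraic (A ⧸ I) E := .tower_top (K := k) (A ⧸ I)
  obtain ⟨τ, hτ⟩ := IsAlgClosed.surjective_domRestrict_of_isAlgebraic (K := k) (E := E) g
  refine ⟨.ofBijective τ (Algebra.IsAlgebraic.algHom_bijective τ), fun a => ?_⟩
  exact (DFunLike.congr_fun hτ (Ideal.Quotient.mk I a)).symm

section Completion

variable {M F Mh Ma : Type*} [Field M] [Field F] [Algebra M F] [Field Mh] [Algebra M Mh]
  [Field Ma] [Algebra Mh Ma] [Algebra M Ma] [IsScalarTower M Mh Ma]
  {vM : AbsoluteValue M ℝ} {vMh : AbsoluteValue Mh ℝ}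

open TensorProduct in
lemma IsCompletion.exists_approx (hMh : IsCompletion vM vMh (algebraMap M Mh))
    {V : AbsoluteValue Ma ℝ} (hV : ExtendsAV vMh V (algebraMap Mh Ma)) {α β : F →ₐ[M] Ma}
    (h : ∀ y, V (α y) = V (β y)) (t : Mh ⊗[M] F) {ε : ℝ} (hε : 0 < ε) :
    ∃ y : F, V (Algebra.TensorProduct.productLeftAlgHom (Algebra.ofId Mh Ma) α t - α y) < ε ∧
      V (Algebra.TensorProduct.productLeftAlgHom (Algebra.ofId Mh Ma) β t - β y) < ε := by
  induction t using TensorProduct.induction_on generalizing ε with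
  | zero => exact ⟨0, by simpa using hε, by simpa using hε⟩
  | tmul m y =>
    have hpos : 0 < V (α y) + 1 := by positivity
    obtain ⟨m', hm'⟩ := hMh.dense m (ε / (V (α y) + 1)) (div_pos hε hpos)
    have key (δ : F →ₐ[M] Ma) (hδ : V (δ y) = V (α y)) :
        V (Algebra.TensorProduct.productLeftAlgHom (Algebra.ofId Mh Ma) δ (m ⊗ₜ y)
          - δ (m' • y)) < ε := by
      have : Algebra.TensorProduct.productLeftAlgHom (Algebra.ofId Mh Ma) δ (m ⊗ₜ y)
          - δ (m' • y) = algebraMap Mh Ma (m - algebraMap M Mh m') * δ y := by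
        rw [map_smul, Algebra.smul_def, IsScalarTower.algebraMap_apply M Mh Ma, map_sub, sub_mul]
        rfl
      rw [this, map_mul, hV, hδ]
      rw [lt_div_iff₀ hpos] at hm'
      nlinarith [vMh.nonneg (m - algebraMap M Mh m')]
    exact ⟨m' • y, key α rfl, key β (h y).symm⟩
  | add s t hs ht =>
    obtain ⟨y, h1, h2⟩ := hs (half_pos hε)
    obtain ⟨z, h3, h4⟩ := ht (half_pos hε)
    refine ⟨y + z, ?_, ?_⟩
    · rw [map_add, map_add, add_sub_add_comm]
      exact (V.add_le _ _).trans_lt (by linarith)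
    · rw [map_add, map_add, add_sub_add_comm]
      exact (V.add_le _ _).trans_lt (by linarith)

open TensorProduct in
/-- Embeddings into an algebraic closure of the completion inducing the same absolute value are
conjugate over the completion. -/
theorem IsCompletion.exists_algEquiv_of_eq [IsAlgClosure Mh Ma]
    (hMh : IsCompletion vM vMh (algebraMap M Mh))
    {V : AbsoluteValue Ma ℝ} (hV : ExtendsAV vMh V (algebraMap Mh Ma)) {α β : F →ₐ[M] Ma}
    (h : ∀ y, V (α y) = V (β y)) : ∃ τ : Ma ≃ₐ[Mh] Ma, ∀ y, β y = τ (α y) := by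
  obtain ⟨τ, hτ⟩ := IsAlgClosure.exists_algEquiv_of_ker_le
    (Algebra.TensorProduct.productLeftAlgHom (Algebra.ofId Mh Ma) α)
    (Algebra.TensorProduct.productLeftAlgHom (Algebra.ofId Mh Ma) β) fun t ht => by
      rw [RingHom.mem_ker] at ht ⊢
      rw [← V.eq_zero]
      refine le_antisymm (le_of_forall_pos_le_add fun ε hε => ?_) (V.nonneg _)
      obtain ⟨y, h1, h2⟩ := hMh.exists_approx hV h t (half_pos hε)
      rw [ht, zero_sub, V.map_neg, h] at h1
      have := V.add_le (Algebra.TensorProduct.productLeftAlgHom (Algebra.ofId Mh Ma) β t - β y)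
        (β y)
      rw [sub_add_cancel] at this
      linarith
  exact ⟨τ, fun y => by simpa using hτ (1 ⊗ₜ y)⟩

end Completion

/-- **Theorem (local).**
Let `F/K` be a field extension with intermediate fields `L`, `M` such that `L/K` and `F/M`
are finite, and let `vL`, `vM` be absolute values on `L`, `M` extending the same absolute
value `vK` on `K`.  Let `K̂, L̂, M̂` be the completions and `M̂ᵃ` an algebraic closure of `M̂`.
Let `ℰ` be the set of `M`-algebra embeddings `α : F → M̂ᵃ` admitting a `K̂`-algebra embedding
`β : L̂ → M̂ᵃ` agreeing with `α` on `L`.  Then there is a bijection between the set of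
absolute values on `F` extending both `vL` and `vM`, and the set of equivalence classes of
`ℰ`, where `α ∼ β` iff they differ by composition with an `M̂`-algebra automorphism of `M̂ᵃ`. -/
theorem local_classification
    {K L M F : Type*} [Field K] [Field L] [Field M] [Field F]
    [Algebra K L] [Algebra K M] [Algebra K F] [Algebra L F] [Algebra M F]
    [IsScalarTower K L F] [IsScalarTower K M F]
    [FiniteDimensional K L] [FiniteDimensional M F]
    (vK : AbsoluteValue K ℝ) (vL : AbsoluteValue L ℝ) (vM : AbsoluteValue M ℝ)
    (hvL : ExtendsAV vK vL (algebraMap K L)) (hvM : ExtendsAV vK vM (algebraMap K M))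
    -- the completions `K̂`, `L̂`, `M̂`
    {Kh Lh Mh : Type*} [Field Kh] [Field Lh] [Field Mh]
    [Algebra K Kh] [Algebra L Lh] [Algebra M Mh]
    [Algebra Kh Lh] [Algebra Kh Mh] [Algebra K Lh] [Algebra K Mh]
    [IsScalarTower K Kh Lh] [IsScalarTower K L Lh]
    [IsScalarTower K Kh Mh] [IsScalarTower K M Mh]
    (vKh : AbsoluteValue Kh ℝ) (vLh : AbsoluteValue Lh ℝ) (vMh : AbsoluteValue Mh ℝ)
    (hKh : IsCompletion vK vKh (algebraMap K Kh))
    (hLh : IsCompletion vL vLh (algebraMap L Lh))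
    (hMh : IsCompletion vM vMh (algebraMap M Mh))
    (hKhLh : ExtendsAV vKh vLh (algebraMap Kh Lh))
    (hKhMh : ExtendsAV vKh vMh (algebraMap Kh Mh))
    -- an algebraic closure `M̂ᵃ` of `M̂`
    {Ma : Type*} [Field Ma] [Algebra Mh Ma] [IsAlgClosure Mh Ma]
    [Algebra Kh Ma] [IsScalarTower Kh Mh Ma]
    [Algebra M Ma] [IsScalarTower M Mh Ma]
    :
    Nonempty (
      {w : AbsoluteValue F ℝ //
        ExtendsAV vL w (algebraMap L F) ∧ ExtendsAV vM w (algebraMap M F)}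
      ≃ Quot (fun α β : {α : F →ₐ[M] Ma // ∃ γ : Lh →ₐ[Kh] Ma,
            ∀ x : L, α (algebraMap L F x) = γ (algebraMap L Lh x)} =>
          ∃ τ : Ma ≃ₐ[Mh] Ma, ∀ y : F, (β : F →ₐ[M] Ma) y = τ ((α : F →ₐ[M] Ma) y))) := by
  have : Algebra.IsAlgebraic Mh Ma := IsAlgClosure.isAlgebraic
  have : IsAlgClosed Ma := IsAlgClosure.isAlgClosed Mh
  have : Algebra.IsAlgebraic Kh Lh := IsCompletion.isAlgebraic hvL hKh hLh hKhLh
  obtain ⟨V, hV⟩ := AbsoluteValue.exists_extends (E := Ma) hMh.complete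
  have hKV (γ : Lh →ₐ[Kh] Ma) : ExtendsAV vLh V (γ : Lh →+* Ma) := by
    have h₁ : ExtendsAV vKh (V.comapRH (γ : Lh →+* Ma)) (algebraMap Kh Lh) := fun x => by
      change V (γ (algebraMap Kh Lh x)) = vKh x
      rw [γ.commutes, IsScalarTower.algebraMap_apply Kh Mh Ma, hV, hKhMh]
    exact DFunLike.congr_fun (AbsoluteValue.eq_of_extends_of_absComplete hKh.complete h₁ hKhLh)
  have hτV (τ : Ma ≃ₐ[Mh] Ma) (x : Ma) : V (τ x) = V x := by
    have h₁ : ExtendsAV vMh (V.comapRH (τ : Ma →+* Ma)) (algebraMap Mh Ma) := fun x => by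
      change V (τ (algebraMap Mh Ma x)) = vMh x
      rw [τ.commutes, hV]
    exact DFunLike.congr_fun
      (AbsoluteValue.eq_of_extends_of_absComplete hMh.complete h₁ hV) x
  have hVL (α : F →ₐ[M] Ma)
      (hα : ∃ γ : Lh →ₐ[Kh] Ma, ∀ x : L, α (algebraMap L F x) = γ (algebraMap L Lh x)) :
      ExtendsAV vL (V.comapRH (α : F →+* Ma)) (algebraMap L F) := by
    obtain ⟨γ, hγ⟩ := hα
    intro x
    change V (α (algebraMap L F x)) = vL x
    rw [hγ]
    exact (hKV γ _).trans (hLh.extendsAV x)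
  have hVM (α : F →ₐ[M] Ma) :
      ExtendsAV vM (V.comapRH (α : F →+* Ma)) (algebraMap M F) := by
    intro x
    change V (α (algebraMap M F x)) = vM x
    rw [α.commutes, IsScalarTower.algebraMap_apply M Mh Ma, hV, hMh.extendsAV]
  refine ⟨(Equiv.ofBijective (Quot.lift (fun α =>
    ⟨V.comapRH (α.1 : F →+* Ma), hVL α.1 α.2, hVM α.1⟩) ?_) ⟨?_, ?_⟩).symm⟩
  · rintro α β ⟨τ, hτ⟩
    refine Subtype.ext (AbsoluteValue.ext fun y => ?_)
    change V (α.1 y) = V (β.1 y)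
    rw [hτ, hτV]
  · rintro ⟨α⟩ ⟨β⟩ h
    exact Quot.sound (hMh.exists_algEquiv_of_eq hV
      (DFunLike.congr_fun (congrArg Subtype.val h)))
  · rintro ⟨w, hwL, hwM⟩
    obtain ⟨Fh, _, g, wh, hg⟩ := exists_isCompletion w
    obtain ⟨hM, hMe, hMg⟩ := hMh.exists_extension hg.complete (g := g.comp (algebraMap M F))
      fun x => (hg.extendsAV _).trans (hwM x)
    obtain ⟨hL, hLe, hLg⟩ := hLh.exists_extension hg.complete (g := g.comp (algebraMap L F))
      fun x => (hg.extendsAV _).trans (hwL x)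
    have hKeq : hL.comp (algebraMap Kh Lh) = hM.comp (algebraMap Kh Mh) := by
      refine hKh.ringHom_ext (vC := wh) (fun x => (hLe _).trans (hKhLh x))
        (fun x => (hMe _).trans (hKhMh x)) fun x => ?_
      change hL (algebraMap Kh Lh _) = hM (algebraMap Kh Mh _)
      rw [← IsScalarTower.algebraMap_apply, ← IsScalarTower.algebraMap_apply,
        IsScalarTower.algebraMap_apply K L Lh, IsScalarTower.algebraMap_apply K M Mh, hLg, hMg]
      change g (algebraMap L F _) = g (algebraMap M F _)
      rw [← IsScalarTower.algebraMap_apply, ← IsScalarTower.algebraMap_apply]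
    let := hM.toAlgebra
    let := g.toAlgebra
    let := (g.comp (algebraMap M F)).toAlgebra
    have : IsScalarTower M Mh Fh := .of_algebraMap_eq fun x => (hMg x).symm
    have : IsScalarTower M F Fh := .of_algebraMap_eq fun _ => rfl
    have : Algebra.IsAlgebraic Mh Fh := IsCompletion.isAlgebraic hwM hMh hg hMe
    let ι : Fh →ₐ[Mh] Ma := IsAlgClosed.lift
    have hι : V.comapRH (ι : Fh →+* Ma) = wh := by
      refine AbsoluteValue.eq_of_extends_of_absComplete hMh.complete (fun x => ?_) hMe
      change V (ι (algebraMap Mh _ x)) = vMh x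
      rw [ι.commutes, hV]
    let α : F →ₐ[M] Ma :=
      (ι.restrictScalars M).comp (IsScalarTower.toAlgHom M F Fh)
    let γ : Lh →ₐ[Kh] Ma :=
      { (ι : Fh →+* Ma).comp hL with
        commutes' := fun x => by
          change ι (hL (algebraMap Kh Lh x)) = _
          rw [IsScalarTower.algebraMap_apply Kh Mh Ma, ← ι.commutes]
          exact congrArg ι (DFunLike.congr_fun hKeq x) }
    refine ⟨Quot.mk _ ⟨α, γ, fun x => congrArg ι (hLg x).symm⟩, Subtype.ext ?_⟩
    ext y
    exact (DFunLike.congr_fun hι (g y)).trans (hg.extendsAV y)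
end
end
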